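/- arXiv:1909.00048 — 3 statements merged into one kernel-verified Lean document; each statement's English description precedes it below -/
import Mathlib

section
/- Let D be the closed unit disk in the Euclidean plane and let x ∈ ∂D. For every open neighborhood U of x there exist an open neighborhood V ⊆ U of x, a point z ∈ V ∩ int D, and a deformation retraction f of D \ {z} onto ∂D such that f maps D \ V into ∂D \ V. -/
open Set Metric Filter

noncomputable section

namespace Cat2Cx

/-! ### Comparison angles -/

/-- Inverse hyperbolic cosine. -/
def arcosh (x : ℝ) : ℝ := Real.log (x + Real.sqrt (x ^ 2 - 1))

/-- The Euclidean comparison angle at the vertex of a (comparison) triangle whose adjacent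
sides have lengths `a`, `b` and whose opposite side has length `c`, via the law of cosines. -/
def euclCompAngle (a b c : ℝ) : ℝ :=
  Real.arccos ((a ^ 2 + b ^ 2 - c ^ 2) / (2 * a * b))

/-- The comparison angle in the model plane `M_κ²` of constant curvature `κ ≤ 0`, via the
(Euclidean or hyperbolic) law of cosines. -/
def compAngle (κ a b c : ℝ) : ℝ :=
  if κ = 0 then euclCompAngle a b c
  else
    Real.arccos
      ((Real.cosh (Real.sqrt (-κ) * a) * Real.cosh (Real.sqrt (-κ) * b) -
          Real.cosh (Real.sqrt (-κ) * c)) /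
        (Real.sinh (Real.sqrt (-κ) * a) * Real.sinh (Real.sqrt (-κ) * b)))

variable {Z : Type*}

/-! ### Geodesics with respect to a distance function -/

/-- `f` restricted to `[a,b]` is a unit-speed geodesic for the distance function `d`
(an isometric embedding of the compact interval `[a,b]`). -/
def IsGeodesicWrt (d : Z → Z → ℝ) (f : ℝ → Z) (a b : ℝ) : Prop :=
  a ≤ b ∧ ∀ s ∈ Icc a b, ∀ t ∈ Icc a b, d (f s) (f t) = |s - t|

/-- `f` is a unit-speed geodesic from `x` to `y` (for the distance function `d`),
staying inside `S`. -/
def IsGeodesicFromTo (d : Z → Z → ℝ) (S : Set Z) (f : ℝ → Z) (x y : Z) : Prop :=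
  f 0 = x ∧ f (d x y) = y ∧ IsGeodesicWrt d f 0 (d x y) ∧ MapsTo f (Icc 0 (d x y)) S

/-- `S`, with the distance function `d`, is a geodesic space. -/
def GeodesicSpaceWrt (d : Z → Z → ℝ) (S : Set Z) : Prop :=
  ∀ x ∈ S, ∀ y ∈ S, ∃ f, IsGeodesicFromTo d S f x y

/-- The geodesic segment `[x,y]`: the union of (the images of) all geodesics from `x` to `y`
inside `S`.  In a uniquely geodesic space this is the image of the unique geodesic. -/
def geodSeg (d : Z → Z → ℝ) (S : Set Z) (x y : Z) : Set Z :=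
  ⋃ f ∈ {f : ℝ → Z | IsGeodesicFromTo d S f x y}, f '' Icc 0 (d x y)

/-- `C ⊆ S` is geodesically convex with respect to `d`: every geodesic (in `S`) between two
points of `C` lies in `C`. -/
def ConvexWrtIn (d : Z → Z → ℝ) (S C : Set Z) : Prop :=
  ∀ x ∈ C, ∀ y ∈ C, geodSeg d S x y ⊆ C

/-- `C` is geodesically convex with respect to `d`. -/
abbrev ConvexWrt (d : Z → Z → ℝ) (C : Set Z) : Prop := ConvexWrtIn d univ C

/-- The geodesically convex hull of `A` with respect to `d`. -/
def convexHullWrt (d : Z → Z → ℝ) (A : Set Z) : Set Z :=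
  ⋂₀ {C | ConvexWrt d C ∧ A ⊆ C}

/-- The Alexandrov (upper) angle at `p` between two paths `σ`, `τ` issuing from `p`
(each parametrized so that `σ 0 = τ 0 = p`): the limit as `ε → 0⁺` (i.e. the infimum over
`ε > 0`) of the supremum over `0 < s, t < ε` of the Euclidean comparison angles. -/
def upperAngleWrt (d : Z → Z → ℝ) (p : Z) (σ τ : ℝ → Z) : ℝ :=
  sInf {a | ∃ ε > 0, a = sSup {b | ∃ s t : ℝ, 0 < s ∧ s < ε ∧ 0 < t ∧ t < ε ∧
      b = euclCompAngle (d p (σ s)) (d p (τ t)) (d (σ s) (τ t))}}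

/-- The CAT(κ) condition (for `κ ≤ 0`), in the angle-comparison form
(Bridson–Haefliger II.1.7(4)): `S` is geodesic and for every triple of distinct points the
Alexandrov angle between geodesics is at most the comparison angle in `M_κ²`. -/
def IsCATWrt (κ : ℝ) (d : Z → Z → ℝ) (S : Set Z) : Prop :=
  GeodesicSpaceWrt d S ∧
    ∀ p ∈ S, ∀ q ∈ S, ∀ r ∈ S, p ≠ q → p ≠ r → q ≠ r →
      ∀ σ τ : ℝ → Z, IsGeodesicFromTo d S σ p q → IsGeodesicFromTo d S τ p r →
        upperAngleWrt d p σ τ ≤ compAngle κ (d p q) (d p r) (d q r)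

/-- Completeness of `S` with respect to the distance function `d`:
every Cauchy sequence converges. -/
def CompleteWrt (d : Z → Z → ℝ) (S : Set Z) : Prop :=
  ∀ u : ℕ → Z, (∀ n, u n ∈ S) →
    (∀ ε > 0, ∃ N, ∀ m ≥ N, ∀ n ≥ N, d (u m) (u n) < ε) →
    ∃ x ∈ S, ∀ ε > 0, ∃ N, ∀ n ≥ N, d (u n) x < ε

variable {X : Type*} [MetricSpace X]

/-- `X` is a CAT(κ) metric space. -/
def IsCATSpace (κ : ℝ) (X : Type*) [MetricSpace X] : Prop :=
  IsCATWrt κ (fun x y : X => dist x y) univ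

/-- The distance function of the metric space `X`. -/
abbrev xDist (X : Type*) [MetricSpace X] : X → X → ℝ := fun x y => dist x y

/-! ### The model plane `M_κ²` and polyhedral 2-complexes -/

/-- The distance function of the model plane `M_κ²` of constant curvature `κ ≤ 0`, in global
coordinates `ℝ²`: the Euclidean distance for `κ = 0`, and for `κ < 0` the distance of the
hyperboloid model rescaled by `1/√(-κ)` (so that the curvature is `κ`). -/
def mDist (κ : ℝ) (u v : ℝ × ℝ) : ℝ :=
  if κ = 0 then Real.sqrt ((u.1 - v.1) ^ 2 + (u.2 - v.2) ^ 2)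
  else
    (1 / Real.sqrt (-κ)) *
      arcosh (Real.sqrt (1 + u.1 ^ 2 + u.2 ^ 2) * Real.sqrt (1 + v.1 ^ 2 + v.2 ^ 2) -
        u.1 * v.1 - u.2 * v.2)

/-- A convex polygonal 2-cell in `M_κ²`: the geodesically convex hull of a finite set of
points, with nonempty interior. -/
def IsPolygonalCell (κ : ℝ) (P : Set (ℝ × ℝ)) : Prop :=
  ∃ F : Finset (ℝ × ℝ), P = convexHullWrt (mDist κ) (F : Set (ℝ × ℝ)) ∧ (interior P).Nonempty

/-- The subset `S` of `X` embeds isometrically into the model plane `M_κ²`. -/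
def IsomEmbedsInModelPlane (κ : ℝ) (S : Set X) : Prop :=
  ∃ f : X → ℝ × ℝ, ∀ x ∈ S, ∀ y ∈ S, mDist κ (f x) (f y) = dist x y

/-- A locally finite `M_κ`-polyhedral 2-complex structure on the metric space `X`:
`X` is partitioned into open 2-cells (faces), open 1-cells (edges) and vertices; the closure of
each face is isometric to a compact convex polygon of the model plane `M_κ²` (so each face has
constant curvature `κ`), each edge is a geodesic arc, and the complex is locally finite. -/
structure PolyComplex2 (κ : ℝ) (X : Type*) [MetricSpace X] where
  faces : Set (Set X)
  edges : Set (Set X)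
  vertices : Set X
  faces_open : ∀ F ∈ faces, IsOpen F
  cover : ⋃₀ faces ∪ ⋃₀ edges ∪ vertices = univ
  cells_disjoint : ∀ c ∈ faces ∪ edges, ∀ c' ∈ faces ∪ edges, c ≠ c' → c ∩ c' = ∅
  cells_vertex_disjoint : ∀ c ∈ faces ∪ edges, c ∩ vertices = ∅
  face_chart : ∀ F ∈ faces, ∃ (f : X → ℝ × ℝ) (P : Set (ℝ × ℝ)),
    IsPolygonalCell κ P ∧ InjOn f (closure F) ∧ f '' closure F = P ∧ f '' F = interior P ∧
    ∀ x ∈ closure F, ∀ y ∈ closure F, mDist κ (f x) (f y) = dist x y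
  edge_geodesic : ∀ e ∈ edges, ∃ (f : ℝ → X) (L : ℝ), 0 < L ∧
    IsGeodesicWrt (fun x y : X => dist x y) f 0 L ∧ f '' Ioo 0 L = e
  edge_closure : ∀ e ∈ edges, closure e \ e ⊆ vertices
  face_closure : ∀ F ∈ faces, closure F \ F ⊆ ⋃₀ edges ∪ vertices
  locally_finite : ∀ x : X, ∃ ε > 0,
    {c | (c ∈ faces ∨ c ∈ edges) ∧ (c ∩ ball x ε).Nonempty}.Finite ∧
    (vertices ∩ ball x ε).Finite

/-! ### Simple closed curves, their interiors, and first homology -/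

/-- A simple closed curve in `X` (identified with its image). -/
structure SCC (X : Type*) [TopologicalSpace X] where
  toFun : ℝ → X
  contOn : ContinuousOn toFun (Icc 0 1)
  loop : toFun 0 = toFun 1
  inj : InjOn toFun (Ico 0 1)

/-- The image of a simple closed curve. -/
def SCC.img {X : Type*} [TopologicalSpace X] (γ : SCC X) : Set X := γ.toFun '' Icc 0 1

/-- The first singular homology class of a loop, via the Hurewicz isomorphism: the class of
the loop in the abelianization of the fundamental group (of its path component); the loop is
nullhomologous iff this class is trivial. -/
def loopClassH1 {B : Type*} [TopologicalSpace B] {x : B} (p : Path x x) :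
    Abelianization (FundamentalGroup B x) :=
  Abelianization.of (FundamentalGroup.fromPath (X := TopCat.of B) ⟦p⟧)

/-- The basepoint of a simple closed curve, regarded in a subspace `B` containing it. -/
def SCC.basePoint {X : Type*} [TopologicalSpace X] (γ : SCC X) (B : Set X)
    (h : γ.img ⊆ B) : B :=
  ⟨γ.toFun 0, h ⟨0, ⟨le_rfl, zero_le_one⟩, rfl⟩⟩

/-- The loop of a simple closed curve, as a `Path` in a subspace `B` containing it. -/
def SCC.pathIn {X : Type*} [TopologicalSpace X] (γ : SCC X) (B : Set X) (h : γ.img ⊆ B) :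
    Path (γ.basePoint B h) (γ.basePoint B h) where
  toFun t := ⟨γ.toFun t, h ⟨(t : ℝ), t.2, rfl⟩⟩
  continuous_toFun := by
    apply Continuous.subtype_mk
    exact γ.contOn.comp_continuous continuous_subtype_val fun t => t.2
  source' := by
    apply Subtype.ext
    rfl
  target' := by
    apply Subtype.ext
    exact γ.loop.symm

/-- The simple closed curve `γ` is nullhomologous in the subspace `B` of `X`:
its class in `H₁(B)` vanishes. -/
def SCC.NullhomologousIn {X : Type*} [TopologicalSpace X] (γ : SCC X) (B : Set X) : Prop :=
  ∀ h : γ.img ⊆ B, loopClassH1 (γ.pathIn B h) = 1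

/-- The interior of a simple closed curve `γ`:
`Int γ = {x ∈ X \ γ | [γ] ≠ 0 ∈ H₁(X \ {x})}`. -/
def SCC.interiorSet {X : Type*} [TopologicalSpace X] (γ : SCC X) : Set X :=
  {x | x ∉ γ.img ∧ ¬ γ.NullhomologousIn {x}ᶜ}

/-- The first singular homology of `B` vanishes: every loop in `B` is nullhomologous
(via the Hurewicz isomorphism on each path component). -/
def H1Trivial (B : Type*) [TopologicalSpace B] : Prop :=
  ∀ (x : B) (p : Path x x), loopClassH1 p = 1

/-! ### Rectifiable connectedness and the induced path metric -/

/-- `g` is a path from `x` to `y` (parametrized by `[0,1]`) inside `E`. -/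
def IsPathIn {X : Type*} [TopologicalSpace X] (E : Set X) (g : ℝ → X) (x y : X) : Prop :=
  ContinuousOn g (Icc 0 1) ∧ g 0 = x ∧ g 1 = y ∧ MapsTo g (Icc 0 1) E

/-- `E` is rectifiably connected: any two of its points are joined by a rectifiable
(finite length) path in `E`. -/
def RectConnected {X : Type*} [MetricSpace X] (E : Set X) : Prop :=
  ∀ x ∈ E, ∀ y ∈ E, ∃ g : ℝ → X, IsPathIn E g x y ∧ eVariationOn g (Icc 0 1) ≠ ⊤

/-- The induced path metric on `E`: the infimum of the lengths of rectifiable paths in `E`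
joining the two points. -/
def pathDistIn {X : Type*} [MetricSpace X] (E : Set X) (x y : X) : ℝ :=
  (⨅ g : {g : ℝ → X // IsPathIn E g x y}, eVariationOn g.1 (Icc 0 1)).toReal


universe u
/-! ### Conical neighborhoods -/


/-- The distance function of the `κ`-cone (κ ≤ 0) over a space with distance function `dL`:
a point is a pair (radius, link point), all points of radius `0` being identified (the cone
point); the distance is given by the law of cosines in curvature `κ`, with angle
`min π (dL ℓ ℓ')`. -/
def coneDist (κ : ℝ) {L : Type*} (dL : L → L → ℝ) (a b : ℝ × L) : ℝ :=
  if κ = 0 then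
    Real.sqrt (a.1 ^ 2 + b.1 ^ 2 - 2 * a.1 * b.1 * Real.cos (min Real.pi (dL a.2 b.2)))
  else
    (1 / Real.sqrt (-κ)) *
      arcosh (Real.cosh (Real.sqrt (-κ) * a.1) * Real.cosh (Real.sqrt (-κ) * b.1) -
        Real.sinh (Real.sqrt (-κ) * a.1) * Real.sinh (Real.sqrt (-κ) * b.1) *
          Real.cos (min Real.pi (dL a.2 b.2)))

/-- `V` is a conical neighborhood of `p` in `X`: an open neighborhood of `p` isometric to a
convex open subset of the `κ`-cone over a metric space (the link of `p`), the isometry taking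
`p` to the cone point. -/
def IsConicalNbhd (κ : ℝ) (p : X) (V : Set X) : Prop :=
  IsOpen V ∧ p ∈ V ∧
    ∃ (L : Type u) (dL : L → L → ℝ) (f : X → ℝ × L),
      (∀ a, dL a a = 0) ∧ (∀ a b, 0 ≤ dL a b) ∧ (∀ a b, dL a b = dL b a) ∧
      (∀ a b c, dL a c ≤ dL a b + dL b c) ∧
      (∀ x ∈ V, 0 ≤ (f x).1) ∧ (f p).1 = 0 ∧
      (∀ x ∈ V, ∀ y ∈ V, dist x y = coneDist κ dL (f x) (f y)) ∧
      (∀ x ∈ V, (f x).1 = 0 → x = p) ∧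
      ConvexWrtIn (coneDist κ dL) {w : ℝ × L | 0 ≤ w.1} (f '' V) ∧
      (∀ z ∈ f '' V, ∃ ε > 0, ∀ w : ℝ × L, 0 ≤ w.1 → coneDist κ dL z w < ε → w ∈ f '' V)

/-! ### Geodesics, triangles, and limit segments in `Y = (E, induced path metric)` -/

/-- The set `α` is (the image of) a geodesic arc of `Y = (E, pathDistIn E)`. -/
def IsYGeodesicArc (E : Set X) (α : Set X) : Prop :=
  ∃ (f : ℝ → X) (a b : ℝ), IsGeodesicWrt (pathDistIn E) f a b ∧
    MapsTo f (Icc a b) E ∧ f '' Icc a b = α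

/-- `T` is a geodesic triangle of `Y = (E, pathDistIn E)` with vertices `p`, `q`, `r`:
the union of the three `Y`-geodesics joining the vertices. -/
def IsYTriangle (E : Set X) (T : Set X) (p q r : X) : Prop :=
  p ∈ E ∧ q ∈ E ∧ r ∈ E ∧
    T = geodSeg (pathDistIn E) E p q ∪ geodSeg (pathDistIn E) E q r ∪
        geodSeg (pathDistIn E) E r p

/-- The set `γim` (a curve in `E`) is locally geodesic in `Y` at `p`: some subarc of `γim`
containing `p` in its relative interior is a geodesic of `Y`. -/
def LocallyYGeodesicAt (E γim : Set X) (p : X) : Prop :=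
  ∃ (f : ℝ → X) (a b t : ℝ), t ∈ Ioo a b ∧ f t = p ∧
    IsGeodesicWrt (pathDistIn E) f a b ∧ MapsTo f (Icc a b) E ∧ f '' Icc a b ⊆ γim

/-- `f : [0,1] → E` is the constant-speed parametrization of the `Y`-geodesic
from `x` to `y`. -/
def IsConstSpeedYGeodesic (E : Set X) (f : ℝ → X) (x y : X) : Prop :=
  f 0 = x ∧ f 1 = y ∧ MapsTo f (Icc 0 1) E ∧
    ∀ s ∈ Icc (0:ℝ) 1, ∀ t ∈ Icc (0:ℝ) 1,
      pathDistIn E (f s) (f t) = pathDistIn E x y * |s - t|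

/-- `R` is the limit segment of length `ε` at `p` of the `Y`-geodesic side from `p` to `q`:
`R` is an `X`-geodesic of length `ε` issuing from `p`, and the `X`-geodesics of length `ε`
from `p` through `σ t` (σ the `Y`-geodesic from `p` to `q`) converge uniformly to `R`
as `t → 0⁺`. -/
def IsLimitSegment (E : Set X) (p q : X) (ε : ℝ) (R : ℝ → X) : Prop :=
  0 < ε ∧ R 0 = p ∧ IsGeodesicWrt (fun x y : X => dist x y) R 0 ε ∧
    ∀ σ : ℝ → X, IsGeodesicFromTo (pathDistIn E) E σ p q →
      ∀ δ > 0, ∃ t₀ > 0, ∀ t, 0 < t → t ≤ t₀ → t ≤ pathDistIn E p q →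
        ∀ g : ℝ → X, IsGeodesicWrt (fun x y : X => dist x y) g 0 ε → g 0 = p →
          g (dist p (σ t)) = σ t → ∀ s ∈ Icc 0 ε, dist (g s) (R s) ≤ δ


end Cat2Cx

end
section RadialProjection

variable {E : Type*} [NormedAddCommGroup E] [InnerProductSpace ℝ E]

/-- The positive scalar `l` for which `z + l • (a - z)` lies on the unit sphere, where `z` is in
the open unit ball and `a ≠ z`. -/
noncomputable def radialScale (z a : E) : ℝ :=
  (Real.sqrt (inner ℝ z (a - z) ^ 2 + ‖a - z‖ ^ 2 * (1 - ‖z‖ ^ 2)) - inner ℝ z (a - z)) /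
    ‖a - z‖ ^ 2

/-- The projection onto the unit sphere along rays issuing from `z`. -/
noncomputable def radialProj (z a : E) : E := z + radialScale z a • (a - z)

theorem continuousOn_radialProj (z : E) : ContinuousOn (radialProj z) {z}ᶜ := by
  unfold radialProj radialScale
  refine continuousOn_const.add (ContinuousOn.smul (ContinuousOn.div ?_ ?_ ?_) ?_)
  · exact Continuous.continuousOn (by fun_prop)
  · exact Continuous.continuousOn (by fun_prop)
  · intro a ha
    have : a - z ≠ 0 := sub_ne_zero.2 ha
    positivity
  · exact Continuous.continuousOn (by fun_prop)

theorem norm_add_smul_sq (z u : E) (l : ℝ) :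
    ‖z + l • u‖ ^ 2 = ‖z‖ ^ 2 + 2 * l * inner ℝ z u + l ^ 2 * ‖u‖ ^ 2 := by
  rw [norm_add_sq_real, inner_smul_right, norm_smul, mul_pow, Real.norm_eq_abs, sq_abs]
  ring

variable {z a : E}

theorem radialScale_pos (hz : ‖z‖ < 1) (ha : a ≠ z) : 0 < radialScale z a := by
  have hu : 0 < ‖a - z‖ := norm_pos_iff.2 (sub_ne_zero.2 ha)
  have hc : 0 < 1 - ‖z‖ ^ 2 := by nlinarith [norm_nonneg z]
  refine div_pos (sub_pos.2 (Real.lt_sqrt_of_sq_lt ?_)) (by positivity)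
  have : 0 < ‖a - z‖ ^ 2 * (1 - ‖z‖ ^ 2) := by positivity
  linarith

theorem norm_radialProj (hz : ‖z‖ < 1) (ha : a ≠ z) : ‖radialProj z a‖ = 1 := by
  have hu : 0 < ‖a - z‖ := norm_pos_iff.2 (sub_ne_zero.2 ha)
  have hc : 0 < 1 - ‖z‖ ^ 2 := by nlinarith [norm_nonneg z]
  have hd : 0 ≤ inner ℝ z (a - z) ^ 2 + ‖a - z‖ ^ 2 * (1 - ‖z‖ ^ 2) := by positivity
  rw [← sq_eq_sq₀ (norm_nonneg _) zero_le_one, radialProj, norm_add_smul_sq, radialScale]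
  have hs := Real.sq_sqrt hd
  set s := Real.sqrt (inner ℝ z (a - z) ^ 2 + ‖a - z‖ ^ 2 * (1 - ‖z‖ ^ 2))
  field_simp
  linear_combination hs

theorem one_le_radialScale (hz : ‖z‖ < 1) (ha : a ≠ z) (ha' : ‖a‖ ≤ 1) :
    1 ≤ radialScale z a := by
  have hl := radialScale_pos hz ha
  by_contra! h
  have hP := norm_radialProj hz ha
  have heq : radialProj z a = (1 - radialScale z a) • z + radialScale z a • a := by
    rw [radialProj]; module
  have := norm_add_le ((1 - radialScale z a) • z) (radialScale z a • a)
  rw [← heq, hP, norm_smul, norm_smul, Real.norm_of_nonneg hl.le,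
    Real.norm_of_nonneg (sub_pos.2 h).le] at this
  nlinarith

theorem radialProj_of_norm_eq_one (hz : ‖z‖ < 1) (ha : ‖a‖ = 1) : radialProj z a = a := by
  have hne : a ≠ z := by rintro rfl; linarith
  have hl := one_le_radialScale hz hne ha.le
  have hP := norm_radialProj hz hne
  suffices radialScale z a = 1 by rw [radialProj, this]; module
  refine le_antisymm ?_ hl
  by_contra! h
  have heq : radialScale z a • a = radialProj z a + (radialScale z a - 1) • z := by
    rw [radialProj]; module
  have := norm_add_le (radialProj z a) ((radialScale z a - 1) • z)
  rw [← heq, hP, norm_smul, norm_smul, ha, Real.norm_of_nonneg (zero_le_one.trans hl),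
    Real.norm_of_nonneg (sub_pos.2 h).le] at this
  nlinarith

theorem mem_segment_radialProj (hz : ‖z‖ < 1) (ha : a ≠ z) (ha' : ‖a‖ ≤ 1) :
    a ∈ segment ℝ z (radialProj z a) := by
  have hl := one_le_radialScale hz ha ha'
  rw [segment_eq_image']
  refine ⟨(radialScale z a)⁻¹, ⟨by positivity, inv_le_one_of_one_le₀ hl⟩, ?_⟩
  simp only [radialProj, add_sub_cancel_left]
  rw [inv_smul_smul₀ (by positivity)]
  abel

end RadialProjection

open Cat2Cx in
/-- **Lemma (disk_lemma).**  Let `D` be the closed unit disk in the plane and `x ∈ ∂D`.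
For every open neighborhood `U` of `x` there are an open neighborhood `V ⊆ U` of `x`, a point
`z ∈ V ∩ int D`, and a deformation retraction of `D \ {z}` onto `∂D` whose final map sends
`D \ V` into `∂D \ V`. -/
theorem disk_deformation_retraction
    (x : EuclideanSpace ℝ (Fin 2)) (hx : x ∈ sphere (0 : EuclideanSpace ℝ (Fin 2)) 1)
    (U : Set (EuclideanSpace ℝ (Fin 2))) (hU : IsOpen U) (hxU : x ∈ U) :
    ∃ V : Set (EuclideanSpace ℝ (Fin 2)), IsOpen V ∧ x ∈ V ∧ V ⊆ U ∧
      ∃ z ∈ V ∩ ball (0 : EuclideanSpace ℝ (Fin 2)) 1,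
        ∃ H : ℝ → EuclideanSpace ℝ (Fin 2) → EuclideanSpace ℝ (Fin 2),
          ContinuousOn (fun w : ℝ × EuclideanSpace ℝ (Fin 2) => H w.1 w.2)
            (Icc (0:ℝ) 1 ×ˢ (closedBall (0 : EuclideanSpace ℝ (Fin 2)) 1 \ {z})) ∧
          (∀ t ∈ Icc (0:ℝ) 1, ∀ a ∈ closedBall (0 : EuclideanSpace ℝ (Fin 2)) 1 \ {z},
            H t a ∈ closedBall (0 : EuclideanSpace ℝ (Fin 2)) 1 \ {z}) ∧
          (∀ a ∈ closedBall (0 : EuclideanSpace ℝ (Fin 2)) 1 \ {z}, H 0 a = a) ∧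
          (∀ a ∈ closedBall (0 : EuclideanSpace ℝ (Fin 2)) 1 \ {z},
            H 1 a ∈ sphere (0 : EuclideanSpace ℝ (Fin 2)) 1) ∧
          (∀ t ∈ Icc (0:ℝ) 1, ∀ b ∈ sphere (0 : EuclideanSpace ℝ (Fin 2)) 1, H t b = b) ∧
          (∀ a ∈ closedBall (0 : EuclideanSpace ℝ (Fin 2)) 1 \ {z}, a ∉ V →
            H 1 a ∈ sphere (0 : EuclideanSpace ℝ (Fin 2)) 1 \ V) := by
  obtain ⟨ε, hε, hεU⟩ := Metric.isOpen_iff.1 hU x hxU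
  have hx1 : ‖x‖ = 1 := by simpa using hx
  obtain ⟨r, hr0, hr1, hrε⟩ : ∃ r : ℝ, 0 < r ∧ r ≤ 1 ∧ r < ε :=
    ⟨min 1 (ε / 2), by positivity, min_le_left _ _, (min_le_right _ _).trans_lt (by linarith)⟩
  set z := (1 - r) • x with hz
  have hzn : ‖z‖ < 1 := by
    rw [hz, norm_smul, hx1, Real.norm_of_nonneg (by linarith)]
    linarith
  have hzV : z ∈ ball x ε := by
    have : z - x = -(r • x) := by rw [hz]; module
    rw [mem_ball, dist_eq_norm, this, norm_neg, norm_smul, hx1, Real.norm_of_nonneg hr0.le]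
    linarith
  refine ⟨ball x ε, isOpen_ball, mem_ball_self hε, hεU, z, ⟨hzV, by simpa using hzn⟩,
    fun t a => (1 - t) • a + t • radialProj z a, ?_, ?_, ?_, ?_, ?_, ?_⟩
  · have hP : ContinuousOn (fun w : ℝ × EuclideanSpace ℝ (Fin 2) => radialProj z w.2)
        (Icc (0:ℝ) 1 ×ˢ (closedBall (0 : EuclideanSpace ℝ (Fin 2)) 1 \ {z})) :=
      (continuousOn_radialProj z).comp continuousOn_snd fun w hw => hw.2.2
    exact ContinuousOn.add (Continuous.continuousOn (by fun_prop)) (continuousOn_fst.smul hP)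
  · rintro t ⟨ht0, ht1⟩ a ⟨ha, hne : a ≠ z⟩
    have ha' : ‖a‖ ≤ 1 := by simpa using ha
    refine ⟨convex_closedBall _ _ ha (by simp [norm_radialProj hzn hne])
      (sub_nonneg.2 ht1) ht0 (by ring), fun h : _ = z => ?_⟩
    have hl := one_le_radialScale hzn hne ha'
    have h0 : ((1 - t) + t * radialScale z a) • (a - z) = 0 := by
      rw [← sub_eq_zero.2 h]
      simp only [radialProj]
      module
    rcases smul_eq_zero.1 h0 with h1 | h1
    · nlinarith
    · exact hne (sub_eq_zero.1 h1)
  · intro a _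
    simp
  · rintro a ⟨_, hne : a ≠ z⟩
    simp [norm_radialProj hzn hne]
  · intro t _ b hb
    simp only [radialProj_of_norm_eq_one hzn (mem_sphere_zero_iff_norm.1 hb)]
    module
  · rintro a ⟨ha, hne : a ≠ z⟩ haV
    have ha' : ‖a‖ ≤ 1 := by simpa using ha
    refine ⟨by simp [norm_radialProj hzn hne], fun h => haV ?_⟩
    have hPV : radialProj z a ∈ ball x ε := by simpa using h
    exact (convex_ball x ε).segment_subset hzV hPV (mem_segment_radialProj hzn hne ha')
end

section
/- Let γ be a simple closed curve in X, and let x be a point of γ that lies on a face of X. Then x is an accumulation point of Int γ. -/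
open Set Metric Filter

namespace Cat2Cx

open scoped Topology

section PlanarTopology

open scoped unitInterval

theorem exists_log_homotopy {A : Type*} [TopologicalSpace A] (H : I × A → ℂ)
    (hH : Continuous H) (h0 : ∀ x, H x ≠ 0) (h1 : ∀ a, H (0, a) = 1) :
    ∃ Λ : I × A → ℂ, Continuous Λ ∧ (∀ x, Complex.exp (Λ x) = H x) ∧ ∀ a, Λ (0, a) = 0 := by
  let H' : C(I × A, {z : ℂ // z ≠ 0}) := ⟨fun x => ⟨H x, h0 x⟩, by fun_prop⟩
  have H0 : ∀ a, H' (0, a) = ⟨_, Complex.exp_ne_zero ((ContinuousMap.const A (0 : ℂ)) a)⟩ := by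
    intro a
    apply Subtype.ext
    simp [H', h1]
  refine ⟨Complex.isCoveringMap_exp.liftHomotopy H' (ContinuousMap.const A 0) H0,
    ContinuousMap.continuous _, fun x => ?_, fun a => ?_⟩
  · exact congrArg Subtype.val
      (congrFun (Complex.isCoveringMap_exp.liftHomotopy_lifts H' (ContinuousMap.const A 0) H0) x)
  · exact Complex.isCoveringMap_exp.liftHomotopy_zero H' (ContinuousMap.const A 0) H0 a

theorem exists_log_path (b : I → ℂ) (hb : Continuous b) (h0 : ∀ t, b t ≠ 0) :
    ∃ Γ : I → ℂ, Continuous Γ ∧ ∀ t, Complex.exp (Γ t) = b t := by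
  obtain ⟨Λ, hΛ, hexp, -⟩ := exists_log_homotopy (A := Unit) (fun x => b x.1 / b 0)
    (by fun_prop) (fun x => div_ne_zero (h0 _) (h0 _)) (fun _ => div_self (h0 _))
  refine ⟨fun t => Λ (t, ()) + Complex.log (b 0), by fun_prop, fun t => ?_⟩
  rw [Complex.exp_add, hexp, Complex.exp_log (h0 0), div_mul_cancel₀ _ (h0 0)]

theorem eq_of_exp_eq {A : Type*} [TopologicalSpace A] [PreconnectedSpace A] {f g : A → ℂ}
    (hf : Continuous f) (hg : Continuous g) (h : ∀ a, Complex.exp (f a) = Complex.exp (g a))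
    (a₀ : A) (h0 : f a₀ = g a₀) : f = g :=
  Complex.isCoveringMap_exp.eq_of_comp_eq hf hg (funext fun a => Subtype.ext (h a)) a₀ h0

/-- A loop that is trivial in `H₁` has closed logarithmic lifts along nonvanishing functions. -/
theorem log_closed_of_loopClassH1_eq_one {B : Type*} [TopologicalSpace B] {b : B} (p : Path b b)
    (h : loopClassH1 p = 1) (g : B → ℂ) (hg : Continuous g) (hg0 : ∀ b, g b ≠ 0)
    (Γ : I → ℂ) (hΓ : Continuous Γ) (hexp : ∀ t, Complex.exp (Γ t) = g (p t)) : Γ 1 = Γ 0 := by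
  let G : C(B, {z : ℂ // z ≠ 0}) := ⟨fun x => ⟨g x, hg0 x⟩, by fun_prop⟩
  have he : (⟨_, Complex.exp_ne_zero (Γ 0)⟩ : {z : ℂ // z ≠ 0}) = G b :=
    Subtype.ext (by simpa [G] using hexp 0)
  let φ := (Complex.isAddQuotientCoveringMap_exp.fundamentalGroupToMulOpposite
    (x := G b) ⟨Γ 0, he⟩).comp (FundamentalGroup.map G b)
  have h1 : φ (FundamentalGroup.fromPath ⟦p⟧) = 1 := by
    have := congrArg (Abelianization.lift φ) h
    rwa [map_one] at this
  have h2 := Complex.isAddQuotientCoveringMap_exp.fundamentalGroupToMulOpposite_eq_one_iff.1 h1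
  have h3 := congrArg Subtype.val h2
  have h4 : Γ = Complex.isCoveringMap_exp.liftPath (G.comp p.toContinuousMap) (Γ 0)
      (by simp [he]) :=
    (Complex.isCoveringMap_exp.eq_liftPath_iff _).2 
      ⟨hΓ, funext fun t => Subtype.ext (hexp t), rfl⟩
  exact (congrFun h4 1).trans h3

/-- The total change of a logarithm of `b - z` along a path `b` depends continuously on `z`. -/
theorem exists_log_change (b : I → ℂ) (hb : Continuous b) :
    ∃ L : ℂ → ℂ, ContinuousOn L (range b)ᶜ ∧ ∀ z, z ∉ range b → ∀ Γ : I → ℂ, Continuous Γ →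
      (∀ t, Complex.exp (Γ t) = b t - z) → L z = Γ 1 - Γ 0 := by
  have hne : ∀ (z : ((range b)ᶜ : Set ℂ)) t, b t - z ≠ 0 := fun z t h =>
    z.2 ⟨t, sub_eq_zero.1 h⟩
  obtain ⟨Λ, hΛ, hexp, h0⟩ := exists_log_homotopy (A := ((range b)ᶜ : Set ℂ))
    (fun x => (b x.1 - x.2) / (b 0 - x.2))
    (Continuous.div (by fun_prop) (by fun_prop) fun x => hne _ _)
    (fun x => div_ne_zero (hne _ _) (hne _ _)) (fun a => div_self (hne _ _))
  classical
  refine ⟨fun z => if h : z ∈ (range b)ᶜ then Λ (1, ⟨z, h⟩) else 0, ?_, ?_⟩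
  · rw [continuousOn_iff_continuous_domRestrict]
    have : Continuous fun z : ((range b)ᶜ : Set ℂ) => Λ (1, z) := by fun_prop
    convert! this using 1
    ext z
    exact dif_pos z.2
  · intro z hz Γ hΓ hΓe
    have hz' : z ∈ (range b)ᶜ := hz
    have := eq_of_exp_eq (f := fun t => Λ (t, ⟨z, hz'⟩)) (g := fun t => Γ t - Γ 0)
      (by fun_prop) (by fun_prop) (fun t => by
        rw [hexp, Complex.exp_sub, hΓe, hΓe]) 0 (by simp [h0])
    simp only [dif_pos hz']
    exact congrFun this 1

/-- There is no continuous logarithm of `(p - z) / (q - z)` on a punctured disc around `p`. -/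
theorem no_log_punctured_ball {p q : ℂ} (hpq : q ≠ p) {ε : ℝ} (hε : 0 < ε) (M : ℂ → ℂ)
    (hM : ContinuousOn M (ball p ε \ {p}))
    (hexp : ∀ z ∈ ball p ε \ {p}, z ≠ q → Complex.exp (M z) = (p - z) / (q - z)) : False := by
  have hd : 0 < dist q p := dist_pos.2 hpq
  obtain ⟨r, hr0, hr⟩ := exists_between (lt_min hε hd)
  have hrε := hr.trans_le (min_le_left _ _)
  have hrd := hr.trans_le (min_le_right _ _)
  rw [dist_eq_norm] at hrd
  have hqp : q - p ≠ 0 := sub_ne_zero.2 hpq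
  let z : ℝ → ℂ := fun θ => p + r * Complex.exp (θ * Complex.I)
  have hzc : Continuous z := by fun_prop
  have hzp : ∀ θ, ‖z θ - p‖ = r := fun θ => by
    simp [z, Complex.norm_exp_ofReal_mul_I, abs_of_pos hr0]
  have hzm : ∀ θ, z θ ∈ ball p ε \ {p} := fun θ => by
    refine ⟨by rw [mem_ball, dist_eq_norm, hzp]; exact hrε, fun h => ?_⟩
    have := hzp θ
    rw [h] at this
    simp at this
    exact hr0.ne this
  have hzq : ∀ θ, z θ ≠ q := fun θ h => by
    have := hzp θ
    rw [h] at this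
    exact hrd.ne' this
  have hslit : ∀ θ, (q - z θ) / (q - p) ∈ Complex.slitPlane := fun θ => by
    have h1 : (q - z θ) / (q - p) = 1 + (-(z θ - p) / (q - p)) := by
      field_simp
      ring
    rw [h1]
    apply Complex.mem_slitPlane_of_norm_lt_one
    rw [norm_div, norm_neg, hzp, div_lt_one (norm_pos_iff.2 hqp)]
    exact hrd
  let ν : ℝ → ℂ := fun θ => M (z θ) + Complex.log ((q - z θ) / (q - p)) - θ * Complex.I
  have hν : Continuous ν := by
    have h1 : Continuous fun θ => M (z θ) := hM.comp_continuous hzc hzm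
    have h2 : Continuous fun θ => Complex.log ((q - z θ) / (q - p)) :=
      Continuous.clog (by fun_prop) hslit
    exact (h1.add h2).sub (by fun_prop)
  have hνe : ∀ θ, Complex.exp (ν θ) = - r / (q - p) := fun θ => by
    have h1 : q - z θ ≠ 0 := sub_ne_zero.2 (hzq θ).symm
    have h2 := Complex.exp_ne_zero (θ * Complex.I)
    simp only [ν]
    rw [Complex.exp_sub, Complex.exp_add, hexp _ (hzm θ) (hzq θ),
      Complex.exp_log (div_ne_zero h1 hqp)]
    field_simp
    simp [z, mul_comm]
  have hconst := eq_of_exp_eq hν (continuous_const (y := ν 0))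
    (fun θ => (hνe θ).trans (hνe 0).symm) 0 rfl
  have h3 := congrFun hconst (2 * Real.pi)
  have hz2 : z (2 * Real.pi) = z 0 := by simp [z]
  simp only [ν, hz2] at h3
  simp [Real.pi_ne_zero] at h3

/-- A closed plane curve which near `p` passes only once through each point has points of nonzero
winding number arbitrarily close to `p`. -/
theorem exists_log_change_ne_zero (β : ℝ → ℂ) (hβ : ContinuousOn β (Icc 0 1)) {c : ℝ}
    (hc : c ∈ Ioo (0 : ℝ) 1) {p : ℂ} (hp : β c = p ∧ β 0 ≠ p ∨ β 0 = p ∧ β c ≠ p)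
    (hloop : β 0 = β 1) {ε : ℝ} (hε : 0 < ε)
    (hinj : ∀ s ∈ Icc 0 c, ∀ t ∈ Icc c 1, β s = β t → β s ∈ ball p ε → β s = p) :
    ∃ z ∈ ball p ε, z ∉ β '' Icc 0 1 ∧ ∃ Γ : I → ℂ, Continuous Γ ∧
      (∀ t : I, Complex.exp (Γ t) = β t - z) ∧ Γ 1 ≠ Γ 0 := by
  by_contra! hcon
  obtain ⟨hc0, hc1⟩ := hc
  have hm1 : ∀ t : I, c * t ∈ Icc 0 c := fun t =>
    ⟨mul_nonneg hc0.le t.2.1, mul_le_of_le_one_right hc0.le t.2.2⟩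
  have hm2 : ∀ t : I, c + (1 - c) * t ∈ Icc c 1 := fun t =>
    ⟨by nlinarith [t.2.1], by nlinarith [t.2.2]⟩
  have hs1 : Icc 0 c ⊆ Icc (0 : ℝ) 1 := Icc_subset_Icc_right hc1.le
  have hs2 : Icc c 1 ⊆ Icc (0 : ℝ) 1 := Icc_subset_Icc_left hc0.le
  let u1 : I → I := fun t => ⟨c * t, hs1 (hm1 t)⟩
  let u2 : I → I := fun t => ⟨c + (1 - c) * t, hs2 (hm2 t)⟩
  have hu1 : Continuous u1 := by fun_prop
  have hu2 : Continuous u2 := by fun_prop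
  have hu10 : u1 0 = 0 := Subtype.ext (by simp [u1])
  have hu11 : u1 1 = u2 0 := Subtype.ext (by simp [u1, u2])
  have hu21 : u2 1 = 1 := Subtype.ext (by simp [u2])
  have hu1c : (u1 1 : ℝ) = c := by simp [u1]
  have hβI : Continuous fun t : I => β t := hβ.comp_continuous continuous_subtype_val fun t => t.2
  let b1 : I → ℂ := fun t => β (u1 t)
  let b2 : I → ℂ := fun t => β (u2 t)
  have hb1 : Continuous b1 := hβI.comp hu1
  have hb2 : Continuous b2 := hβI.comp hu2
  obtain ⟨L1, hL1, hL1'⟩ := exists_log_change b1 hb1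
  obtain ⟨L2, hL2, hL2'⟩ := exists_log_change b2 hb2
  have hr1 : IsClosed (range b1) := (isCompact_range hb1).isClosed
  have hr2 : IsClosed (range b2) := (isCompact_range hb2).isClosed
  have hcover : ∀ z ∈ β '' Icc 0 1, z ∈ range b1 ∨ z ∈ range b2 := by
    rintro _ ⟨t, ht, rfl⟩
    rcases le_total t c with h | h
    · refine Or.inl ⟨⟨t / c, div_nonneg ht.1 hc0.le, (div_le_one hc0).2 h⟩, ?_⟩
      simp only [b1, u1]
      congr 1
      field_simp
    · have h1c : 0 < 1 - c := sub_pos.2 hc1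
      refine Or.inr ⟨⟨(t - c) / (1 - c), div_nonneg (sub_nonneg.2 h) h1c.le,
        (div_le_one h1c).2 (by linarith [ht.2])⟩, ?_⟩
      simp only [b2, u2]
      congr 1
      field_simp
      ring
  have hsum : ∀ z ∈ ball p ε, z ∉ range b1 → z ∉ range b2 → L1 z = - L2 z := by
    intro z hz h1 h2
    have hzK : z ∉ β '' Icc 0 1 := fun h => (hcover z h).elim h1 h2
    obtain ⟨Γ, hΓ, hΓe⟩ := exists_log_path (fun t : I => β t - z)
      (hβI.sub continuous_const)
      (fun t h => hzK ⟨t, t.2, sub_eq_zero.1 h⟩)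
    have h := hcon z hz hzK Γ hΓ hΓe
    rw [hL1' z h1 (fun t => Γ (u1 t)) (by fun_prop) (fun t => hΓe _),
      hL2' z h2 (fun t => Γ (u2 t)) (by fun_prop) (fun t => hΓe _), hu10, hu11, hu21, h]
    ring
  have hone : ∀ z ∈ ball p ε \ {p}, z ∈ range b1 → z ∉ range b2 := by
    rintro z ⟨hz, hzp⟩ ⟨s, hs⟩ ⟨t, ht⟩
    apply hzp
    have := hinj _ (hm1 s) _ (hm2 t) (hs.trans ht.symm) (mem_of_eq_of_mem hs hz)
    exact hs.symm.trans this
  have hexp1 : ∀ z, z ∉ range b1 → Complex.exp (L1 z) = (β c - z) / (β 0 - z) := by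
    intro z hz
    obtain ⟨Γ, hΓ, hΓe⟩ := exists_log_path (fun t : I => b1 t - z) (by fun_prop)
      (fun t h => hz ⟨t, sub_eq_zero.1 h⟩)
    rw [hL1' z hz Γ hΓ hΓe, Complex.exp_sub, hΓe, hΓe]
    simp [b1, u1]
  have hexp2 : ∀ z, z ∉ range b2 → Complex.exp (-L2 z) = (β c - z) / (β 0 - z) := by
    intro z hz
    obtain ⟨Γ, hΓ, hΓe⟩ := exists_log_path (fun t : I => b2 t - z) (by fun_prop)
      (fun t h => hz ⟨t, sub_eq_zero.1 h⟩)
    rw [hL2' z hz Γ hΓ hΓe, neg_sub, Complex.exp_sub, hΓe, hΓe]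
    simp [b2, u2, hloop]
  classical
  let M : ℂ → ℂ := fun z => if z ∈ range b1 then - L2 z else L1 z
  have hMexp : ∀ z ∈ ball p ε \ {p}, Complex.exp (M z) = (β c - z) / (β 0 - z) := by
    intro z hz
    by_cases h : z ∈ range b1
    · simp only [M, if_pos h]
      exact hexp2 z (hone z hz h)
    · simp only [M, if_neg h]
      exact hexp1 z h
  have hMc : ContinuousOn M (ball p ε \ {p}) := by
    intro z hz
    apply ContinuousAt.continuousWithinAt
    by_cases h : z ∈ range b1
    · have h2 := hone z hz h
      have hn : (range b2)ᶜ ∈ 𝓝 z := hr2.isOpen_compl.mem_nhds h2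
      refine ((hL2.continuousAt hn).neg).congr ?_
      filter_upwards [hn, isOpen_ball.mem_nhds hz.1] with w hw hwb
      by_cases hw1 : w ∈ range b1
      · simp only [M, if_pos hw1, Pi.neg_apply]
      · simp only [M, if_neg hw1, Pi.neg_apply]
        exact (hsum w hwb hw1 hw).symm
    · have hn : (range b1)ᶜ ∈ 𝓝 z := hr1.isOpen_compl.mem_nhds h
      refine (hL1.continuousAt hn).congr ?_
      filter_upwards [hn] with w hw
      simp only [M]
      rw [if_neg hw]
  rcases hp with ⟨hcp, h0p⟩ | ⟨h0p, hcp⟩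
  · refine no_log_punctured_ball h0p hε M hMc fun z hz _ => ?_
    rw [hMexp z hz, hcp]
  · refine no_log_punctured_ball hcp hε (fun z => - M z) hMc.neg fun z hz _ => ?_
    rw [Complex.exp_neg, hMexp z hz, h0p, inv_div]

end PlanarTopology

theorem upperAngleWrt_nonneg {Z : Type*} {d : Z → Z → ℝ} {p : Z} {σ τ : ℝ → Z} :
    0 ≤ upperAngleWrt d p σ τ := by
  apply Real.sInf_nonneg
  rintro a ⟨ε, -, rfl⟩
  apply Real.sSup_nonneg
  rintro b ⟨s, t, -, -, -, -, rfl⟩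
  exact Real.arccos_nonneg _

theorem exists_lt_of_lt_cos_upperAngleWrt {Z : Type*} {d : Z → Z → ℝ} {p : Z} {σ τ : ℝ → Z}
    {c : ℝ} (hc : -1 ≤ c) (h : c < Real.cos (upperAngleWrt d p σ τ)) :
    ∃ ε > 0, ∀ s t : ℝ, 0 < s → s < ε → 0 < t → t < ε →
      c < (d p (σ s) ^ 2 + d p (τ t) ^ 2 - d (σ s) (τ t) ^ 2) /
        (2 * d p (σ s) * d p (τ t)) := by
  have hpi : ∀ ε : ℝ, ∀ b ∈ {b | ∃ s t : ℝ, 0 < s ∧ s < ε ∧ 0 < t ∧ t < ε ∧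
      b = euclCompAngle (d p (σ s)) (d p (τ t)) (d (σ s) (τ t))}, 0 ≤ b ∧ b ≤ Real.pi := by
    rintro ε b ⟨s, t, -, -, -, -, rfl⟩
    exact ⟨Real.arccos_nonneg _, Real.arccos_le_pi _⟩
  have h0 : 0 ≤ upperAngleWrt d p σ τ := upperAngleWrt_nonneg
  have h1 : upperAngleWrt d p σ τ ≤ Real.pi := by
    refine le_trans (csInf_le ⟨0, ?_⟩ ⟨1, one_pos, rfl⟩)
      (Real.sSup_le (fun b hb => (hpi 1 b hb).2) Real.pi_pos.le)
    rintro a ⟨ε, -, rfl⟩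
    exact Real.sSup_nonneg fun b hb => (hpi ε b hb).1
  have h2 : upperAngleWrt d p σ τ < Real.arccos c := by
    rw [← Real.arccos_cos h0 h1]
    exact Real.strictAntiOn_arccos ⟨hc, h.le.trans (Real.cos_le_one _)⟩
      ⟨Real.neg_one_le_cos _, Real.cos_le_one _⟩ h
  obtain ⟨a, ⟨ε, hε, rfl⟩, ha⟩ := exists_lt_of_csInf_lt (by exact ⟨_, 1, one_pos, rfl⟩) h2
  refine ⟨ε, hε, fun s t hs hs' ht ht' => ?_⟩
  have h3 : euclCompAngle (d p (σ s)) (d p (τ t)) (d (σ s) (τ t)) < Real.arccos c :=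
    lt_of_le_of_lt (le_csSup ⟨Real.pi, fun b hb => (hpi ε b hb).2⟩
      ⟨s, t, hs, hs', ht, ht', rfl⟩) ha
  by_contra! hle
  exact absurd h3 (not_lt.2 (Real.antitone_arccos hle))

/-- Adjacent angles along a geodesic add up to at least `π`. -/
theorem cos_upperAngle_add_cos_upperAngle_nonpos {X : Type*} [MetricSpace X] {m : X}
    {σ τ₁ τ₂ : ℝ → X} {δ : ℝ} (hδ : 0 < δ) (hσ : ∀ t ∈ Ioo 0 δ, dist m (σ t) = t)
    (h₁ : ∀ t ∈ Ioo 0 δ, dist m (τ₁ t) = t) (h₂ : ∀ t ∈ Ioo 0 δ, dist m (τ₂ t) = t)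
    (h₁₂ : ∀ t ∈ Ioo 0 δ, dist (τ₁ t) (τ₂ t) = 2 * t) :
    Real.cos (upperAngleWrt (fun x y : X => dist x y) m σ τ₁) +
      Real.cos (upperAngleWrt (fun x y : X => dist x y) m σ τ₂) ≤ 0 := by
  by_contra! hpos
  set C₁ := Real.cos (upperAngleWrt (fun x y : X => dist x y) m σ τ₁)
  set C₂ := Real.cos (upperAngleWrt (fun x y : X => dist x y) m σ τ₂)
  have hC₁ : C₁ ≤ 1 := Real.cos_le_one _
  have hC₂ : C₂ ≤ 1 := Real.cos_le_one _
  obtain ⟨η, hη⟩ : ∃ η, η = (C₁ + C₂) / 4 := ⟨_, rfl⟩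
  obtain ⟨ε₁, hε₁, H₁⟩ := exists_lt_of_lt_cos_upperAngleWrt
    (c := C₁ - η) (by linarith) (show C₁ - η < C₁ by linarith)
  obtain ⟨ε₂, hε₂, H₂⟩ := exists_lt_of_lt_cos_upperAngleWrt
    (c := C₂ - η) (by linarith) (show C₂ - η < C₂ by linarith)
  obtain ⟨t, ht0, ht⟩ := exists_between (lt_min hδ (lt_min hε₁ hε₂))
  have htδ : t < δ := ht.trans_le (min_le_left _ _)
  have ht₁ : t < ε₁ := ht.trans_le ((min_le_right _ _).trans (min_le_left _ _))
  have ht₂ : t < ε₂ := ht.trans_le ((min_le_right _ _).trans (min_le_right _ _))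
  have hη0 : 0 < η := by linarith
  have hη1 : η ≤ 1 / 2 := by linarith
  have hs0 : 0 < η * t := mul_pos hη0 ht0
  have hst : η * t < t := by nlinarith
  have K₁ := H₁ (η * t) t hs0 (hst.trans ht₁) ht0 ht₁
  have K₂ := H₂ (η * t) t hs0 (hst.trans ht₂) ht0 ht₂
  simp only [hσ _ ⟨hs0, hst.trans htδ⟩, h₁ t ⟨ht0, htδ⟩, h₂ t ⟨ht0, htδ⟩] at K₁ K₂
  rw [lt_div_iff₀ (by positivity)] at K₁ K₂
  have htri := dist_triangle_left (τ₁ t) (τ₂ t) (σ (η * t))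
  rw [h₁₂ t ⟨ht0, htδ⟩] at htri
  set d₁ := dist (σ (η * t)) (τ₁ t)
  set d₂ := dist (σ (η * t)) (τ₂ t)
  -- `2 t dᵢ ≤ t² + dᵢ²`, and the sum of the squares is too small
  have e1 : 2 * t * (d₁ + d₂) ≤ 2 * t ^ 2 + d₁ ^ 2 + d₂ ^ 2 := by
    nlinarith [sq_nonneg (d₁ - t), sq_nonneg (d₂ - t)]
  have e2 : 2 * t * (2 * t) ≤ 2 * t * (d₁ + d₂) := by gcongr
  have e3 : C₁ + C₂ = 4 * η := by linarith
  have e4 : d₁ ^ 2 + d₂ ^ 2 < 2 * (η * t) ^ 2 + 2 * t ^ 2 - 2 * (η * t) * t * (2 * η) := by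
    have : (C₁ - η + (C₂ - η)) = 2 * η := by linarith
    rw [← this]; linarith
  nlinarith [mul_pos hs0 hs0]

theorem le_cos_arccos {v : ℝ} (hv : v ≤ 1) : v ≤ Real.cos (Real.arccos v) := by
  rcases le_total (-1) v with h | h
  · rw [Real.cos_arccos h hv]
  · exact h.trans (Real.neg_one_le_cos _)

theorem cos_compAngle_zero_le {a b c θ : ℝ} (ha : 0 < a) (hb : 0 < b)
    (hab : |a - b| ≤ c) (hθ0 : 0 ≤ θ) (hθ : θ ≤ compAngle 0 a b c) :
    a ^ 2 + b ^ 2 - c ^ 2 ≤ 2 * a * b * Real.cos θ := by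
  simp only [compAngle, if_true, euclCompAngle] at hθ
  have h1 : (a ^ 2 + b ^ 2 - c ^ 2) / (2 * a * b) ≤ 1 := by
    rw [div_le_one (by positivity)]
    have : (a - b) ^ 2 ≤ c ^ 2 := sq_le_sq' (by linarith [abs_le.1 hab]) (abs_le.1 hab).2
    nlinarith
  have h2 := (le_cos_arccos h1).trans
    (Real.cos_le_cos_of_nonneg_of_le_pi hθ0 (Real.arccos_le_pi _) hθ)
  rw [div_le_iff₀ (by positivity)] at h2
  linarith

theorem cos_compAngle_neg_le {κ a b c θ : ℝ} (hκ : κ < 0) (ha : 0 < a) (hb : 0 < b)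
    (hab : |a - b| ≤ c) (hθ0 : 0 ≤ θ) (hθ : θ ≤ compAngle κ a b c) :
    Real.cosh (√(-κ) * a) * Real.cosh (√(-κ) * b) - Real.cosh (√(-κ) * c) ≤
      Real.sinh (√(-κ) * a) * Real.sinh (√(-κ) * b) * Real.cos θ := by
  simp only [compAngle, if_neg hκ.ne] at hθ
  have hk : 0 < √(-κ) := Real.sqrt_pos.2 (by linarith)
  have hsa : 0 < Real.sinh (√(-κ) * a) := Real.sinh_pos_iff.2 (by positivity)
  have hsb : 0 < Real.sinh (√(-κ) * b) := Real.sinh_pos_iff.2 (by positivity)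
  have h1 : (Real.cosh (√(-κ) * a) * Real.cosh (√(-κ) * b) - Real.cosh (√(-κ) * c)) /
      (Real.sinh (√(-κ) * a) * Real.sinh (√(-κ) * b)) ≤ 1 := by
    rw [div_le_one (by positivity)]
    have : Real.cosh (√(-κ) * a - √(-κ) * b) ≤ Real.cosh (√(-κ) * c) := by
      rw [Real.cosh_le_cosh, ← mul_sub, abs_mul, abs_mul]
      exact mul_le_mul_of_nonneg_left (hab.trans (le_abs_self _)) (abs_nonneg _)
    rw [Real.cosh_sub] at this
    linarith
  have h2 := (le_cos_arccos h1).trans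
    (Real.cos_le_cos_of_nonneg_of_le_pi hθ0 (Real.arccos_le_pi _) hθ)
  rw [div_le_iff₀ (by positivity)] at h2
  linarith

theorem one_add_sq_div_two_le_cosh {x : ℝ} (hx : 0 ≤ x) : 1 + x ^ 2 / 2 ≤ Real.cosh x := by
  have h1 : x / 2 ≤ Real.sinh (x / 2) := Real.self_le_sinh_iff.2 (by positivity)
  have h2 : Real.cosh x = 1 + 2 * Real.sinh (x / 2) ^ 2 := by
    have := Real.cosh_two_mul (x / 2)
    rw [Real.cosh_sq, mul_div_cancel₀ x two_ne_zero] at this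
    linarith
  nlinarith

/-- Two points at distance `r` from `x`, the first one on a geodesic from `x` to `z`, are
close to each other if the second is not much farther from `z` than the first. -/
theorem exists_bound_dist_geodesic {κ : ℝ} (hκ : κ ≤ 0) {X : Type*} [MetricSpace X]
    (hX : IsCATSpace κ X) {r L : ℝ} (hr : 0 < r) (hL : r < L) :
    ∃ E : ℝ → ℝ, Continuous E ∧ E (L - r) = 0 ∧ ∀ (x z p : X) (f : ℝ → X), dist x z = L →
      IsGeodesicFromTo (fun x y : X => dist x y) univ f x z → dist x p = r →
      ∀ b, dist p z ≤ b → dist (f r) p ^ 2 ≤ E b := by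
  have key : ∀ (x z p : X) (f : ℝ → X), dist x z = L →
      IsGeodesicFromTo (fun x y : X => dist x y) univ f x z → dist x p = r → f r ≠ p →
      ∃ θ₁ θ₂ : ℝ, 0 ≤ θ₁ ∧ 0 ≤ θ₂ ∧ Real.cos θ₁ + Real.cos θ₂ ≤ 0 ∧
        θ₁ ≤ compAngle κ (dist (f r) p) r r ∧
        θ₂ ≤ compAngle κ (dist (f r) p) (L - r) (dist p z) := by
    rintro x z p f hxz ⟨hf0, hf1, ⟨-, hf⟩, -⟩ hxp hne
    simp only [hxz] at hf1 hf
    have hmx : dist (f r) x = r := by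
      rw [← hf0, hf r ⟨hr.le, hL.le⟩ 0 ⟨le_rfl, by linarith⟩, sub_zero, abs_of_pos hr]
    have hmz : dist (f r) z = L - r := by
      rw [← hf1, hf r ⟨hr.le, hL.le⟩ L ⟨by linarith, le_rfl⟩, abs_sub_comm,
        abs_of_pos (by linarith)]
    have hpz : p ≠ z := fun h => by rw [h, hxz] at hxp; linarith
    have hpx : p ≠ x := fun h => by rw [h, dist_self] at hxp; linarith
    have hmx' : f r ≠ x := fun h => by rw [h, dist_self] at hmx; linarith
    have hmz' : f r ≠ z := fun h => by rw [h, dist_self] at hmz; linarith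
    obtain ⟨g, hg⟩ := hX.1 (f r) (mem_univ _) p (mem_univ _)
    have hτ₁ : IsGeodesicFromTo (fun x y : X => dist x y) univ (fun t => f (r - t)) (f r) x := by
      refine ⟨by simp, by simp [hmx, hf0], ⟨by simp, fun s hs t ht => ?_⟩, fun _ _ => mem_univ _⟩
      simp only [hmx] at hs ht ⊢
      rw [hf _ ⟨by linarith [hs.2], by linarith [hs.1]⟩ _
        ⟨by linarith [ht.2], by linarith [ht.1]⟩, abs_sub_comm]
      congr 1
      ring
    have hτ₂ : IsGeodesicFromTo (fun x y : X => dist x y) univ (fun t => f (r + t)) (f r) z := by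
      refine ⟨by simp, by simp [hmz, hf1], ⟨by simp, fun s hs t ht => ?_⟩, fun _ _ => mem_univ _⟩
      simp only [hmz] at hs ht ⊢
      rw [hf _ ⟨by linarith [hs.1], by linarith [hs.2]⟩ _
        ⟨by linarith [ht.1], by linarith [ht.2]⟩]
      congr 1
      ring
    refine ⟨_, _, upperAngleWrt_nonneg, upperAngleWrt_nonneg,
      cos_upperAngle_add_cos_upperAngle_nonpos (m := f r) (σ := g) (τ₁ := fun t => f (r - t))
        (τ₂ := fun t => f (r + t))
        (lt_min (dist_pos.2 hne) (lt_min hr (sub_pos.2 hL))) ?_ ?_ ?_ ?_, ?_, ?_⟩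
    · rintro t ⟨ht0, ht⟩
      have h1 : t < dist (f r) p := ht.trans_le (min_le_left _ _)
      obtain ⟨hg0, -, ⟨-, hg⟩, -⟩ := hg
      have := hg 0 ⟨le_rfl, dist_nonneg⟩ t ⟨ht0.le, h1.le⟩
      rw [hg0] at this
      simpa [abs_of_pos ht0] using this
    · rintro t ⟨ht0, ht⟩
      have h1 : t < r := ht.trans_le ((min_le_right _ _).trans (min_le_left _ _))
      rw [hf _ ⟨hr.le, hL.le⟩ _ ⟨by linarith, by linarith⟩]
      simp [abs_of_pos ht0]
    · rintro t ⟨ht0, ht⟩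
      have h1 : t < L - r := ht.trans_le ((min_le_right _ _).trans (min_le_right _ _))
      rw [hf _ ⟨hr.le, hL.le⟩ _ ⟨by linarith, by linarith⟩]
      simp [abs_of_pos ht0]
    · rintro t ⟨ht0, ht⟩
      have h1 : t < r := ht.trans_le ((min_le_right _ _).trans (min_le_left _ _))
      have h2 : t < L - r := ht.trans_le ((min_le_right _ _).trans (min_le_right _ _))
      rw [hf _ ⟨by linarith, by linarith⟩ _ ⟨by linarith, by linarith⟩,
        show r - t - (r + t) = -(2 * t) by ring, abs_neg, abs_of_pos (by linarith)]
    · have := hX.2 (f r) (mem_univ _) p (mem_univ _) x (mem_univ _) hne hmx' hpx g _ hg hτ₁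
      simpa only [hmx, dist_comm p x, hxp] using this
    · have := hX.2 (f r) (mem_univ _) p (mem_univ _) z (mem_univ _) hne hmz' hpz g _ hg hτ₂
      simpa only [hmz] using this
  have hmr : ∀ (x z p : X) (f : ℝ → X), dist x z = L →
      IsGeodesicFromTo (fun x y : X => dist x y) univ f x z → dist x p = r →
      |dist (f r) p - r| ≤ r ∧ |dist (f r) p - (L - r)| ≤ dist p z := by
    rintro x z p f hxz ⟨hf0, hf1, ⟨-, hf⟩, -⟩ hxp
    simp only [hxz] at hf1 hf
    have hmx : dist (f r) x = r := by
      rw [← hf0, hf r ⟨hr.le, hL.le⟩ 0 ⟨le_rfl, by linarith⟩, sub_zero, abs_of_pos hr]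
    have hmz : dist (f r) z = L - r := by
      rw [← hf1, hf r ⟨hr.le, hL.le⟩ L ⟨by linarith, le_rfl⟩, abs_sub_comm,
        abs_of_pos (by linarith)]
    constructor
    · have h := abs_dist_sub_le p x (f r)
      rwa [dist_comm p, dist_comm x, hmx, dist_comm p x, hxp] at h
    · have h := abs_dist_sub_le p z (f r)
      rwa [dist_comm p, dist_comm z, hmz] at h
  have hL0 : 0 < L := hr.trans hL
  have hl : 0 < L - r := sub_pos.2 hL
  rcases hκ.eq_or_lt with rfl | hκ
  · refine ⟨fun b => r * (b ^ 2 - (L - r) ^ 2) / L, by fun_prop, by simp, ?_⟩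
    intro x z p f hxz hf hxp b hb
    have hE : r * (dist p z ^ 2 - (L - r) ^ 2) / L ≤ r * (b ^ 2 - (L - r) ^ 2) / L := by gcongr
    refine le_trans ?_ hE
    obtain ⟨a1, a2⟩ := hmr x z p f hxz hf hxp
    rw [le_div_iff₀ hL0]
    rcases eq_or_ne (f r) p with he | hne
    · rw [he, dist_self, zero_sub, abs_neg, abs_of_pos hl] at a2
      rw [he, dist_self]
      have : (L - r) ^ 2 ≤ dist p z ^ 2 := by gcongr
      nlinarith
    · obtain ⟨θ₁, θ₂, h1, h2, hsum, h3, h4⟩ := key x z p f hxz hf hxp hne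
      have hm := dist_pos.2 hne
      have k1 := cos_compAngle_zero_le hm hr a1 h1 h3
      have k2 := cos_compAngle_zero_le hm hl a2 h2 h4
      set m := dist (f r) p
      have k3 : (L - r) * (m ^ 2 + r ^ 2 - r ^ 2) + r * (m ^ 2 + (L - r) ^ 2 - dist p z ^ 2) ≤
          2 * m * r * (L - r) * (Real.cos θ₁ + Real.cos θ₂) := by
        nlinarith [mul_le_mul_of_nonneg_left k1 hl.le, mul_le_mul_of_nonneg_left k2 hr.le]
      have k4 : 2 * m * r * (L - r) * (Real.cos θ₁ + Real.cos θ₂) ≤ 0 :=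
        mul_nonpos_of_nonneg_of_nonpos (by positivity) hsum
      nlinarith
  · obtain ⟨k, hk⟩ : ∃ k, k = √(-κ) := ⟨_, rfl⟩
    have hk0 : 0 < k := hk ▸ Real.sqrt_pos.2 (by linarith)
    have hsr : 0 < Real.sinh (k * r) := Real.sinh_pos_iff.2 (by positivity)
    have hsl : 0 < Real.sinh (k * (L - r)) := Real.sinh_pos_iff.2 (by positivity)
    have hsL : 0 < Real.sinh (k * L) := Real.sinh_pos_iff.2 (by positivity)
    refine ⟨fun b => 2 / k ^ 2 * (Real.sinh (k * r) *
      (Real.cosh (k * b) - Real.cosh (k * (L - r))) / Real.sinh (k * L)), ?_, by simp, ?_⟩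
    · have := Real.continuous_cosh
      fun_prop
    intro x z p f hxz hf hxp b hb
    have hmono : Real.cosh (k * dist p z) ≤ Real.cosh (k * b) := by
      rw [Real.cosh_le_cosh, abs_mul, abs_mul, abs_of_nonneg dist_nonneg]
      exact mul_le_mul_of_nonneg_left (hb.trans (le_abs_self _)) (abs_nonneg _)
    have hE : Real.sinh (k * r) *
        (Real.cosh (k * dist p z) - Real.cosh (k * (L - r))) / Real.sinh (k * L) ≤
        Real.sinh (k * r) *
        (Real.cosh (k * b) - Real.cosh (k * (L - r))) / Real.sinh (k * L) := by gcongr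
    obtain ⟨a1, a2⟩ := hmr x z p f hxz hf hxp
    have hM : Real.cosh (k * dist (f r) p) - 1 ≤ Real.sinh (k * r) *
        (Real.cosh (k * dist p z) - Real.cosh (k * (L - r))) / Real.sinh (k * L) := by
      rw [le_div_iff₀ hsL]
      rcases eq_or_ne (f r) p with he | hne
      · rw [he, dist_self, zero_sub, abs_neg, abs_of_pos hl] at a2
        rw [he, dist_self]
        have : Real.cosh (k * (L - r)) ≤ Real.cosh (k * dist p z) := by
          rw [Real.cosh_le_cosh, abs_mul, abs_mul, abs_of_pos hl]
          exact mul_le_mul_of_nonneg_left (a2.trans (le_abs_self _)) (abs_nonneg _)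
        simp only [mul_zero, Real.cosh_zero, sub_self, zero_mul]
        exact mul_nonneg hsr.le (by linarith)
      · obtain ⟨θ₁, θ₂, h1, h2, hsum, h3, h4⟩ := key x z p f hxz hf hxp hne
        have hm := dist_pos.2 hne
        have k1 := cos_compAngle_neg_le hκ hm hr a1 h1 h3
        have k2 := cos_compAngle_neg_le hκ hm hl a2 h2 h4
        rw [← hk] at k1 k2
        have hadd : Real.sinh (k * L) = Real.sinh (k * r) * Real.cosh (k * (L - r)) +
            Real.cosh (k * r) * Real.sinh (k * (L - r)) := by
          rw [← Real.sinh_add]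
          congr 1
          ring
        have hsm : 0 < Real.sinh (k * dist (f r) p) := Real.sinh_pos_iff.2 (by positivity)
        have k4 : Real.sinh (k * dist (f r) p) * Real.sinh (k * r) * Real.sinh (k * (L - r)) *
            (Real.cos θ₁ + Real.cos θ₂) ≤ 0 :=
          mul_nonpos_of_nonneg_of_nonpos (by positivity) hsum
        rw [hadd]
        linarith [mul_le_mul_of_nonneg_left k1 hsl.le, mul_le_mul_of_nonneg_left k2 hsr.le]
    have hc := one_add_sq_div_two_le_cosh (x := k * dist (f r) p) (by positivity)
    have h5 : dist (f r) p ^ 2 = 2 / k ^ 2 * ((k * dist (f r) p) ^ 2 / 2) := by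
      field_simp
    rw [h5]
    exact mul_le_mul_of_nonneg_left (by linarith) (by positivity)

/-- In a CAT(κ) space with `κ ≤ 0`, radial projection onto a closed ball is continuous. -/
theorem exists_continuous_radial_projection {κ : ℝ} (hκ : κ ≤ 0) {X : Type*} [MetricSpace X]
    (hX : IsCATSpace κ X) (x : X) {r : ℝ} (hr : 0 < r) :
    ∃ ρ : X → X, Continuous ρ ∧ (∀ z, dist x (ρ z) ≤ r) ∧ (∀ z, dist x z ≤ r → ρ z = z) ∧
      ∀ z, dist x (ρ z) < r → ρ z = z := by
  classical
  choose f hf using fun z => hX.1 x (mem_univ x) z (mem_univ z)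
  have hxf : ∀ z, r < dist x z → dist x (f z r) = r := by
    intro z hz
    obtain ⟨h0, -, ⟨-, hd⟩, -⟩ := hf z
    have := hd 0 ⟨le_rfl, dist_nonneg⟩ r ⟨hr.le, hz.le⟩
    rw [h0] at this
    simpa [abs_of_pos hr] using this
  have hzf : ∀ z, r < dist x z → dist (f z r) z = dist x z - r := by
    intro z hz
    obtain ⟨-, h1, ⟨-, hd⟩, -⟩ := hf z
    have := hd r ⟨hr.le, hz.le⟩ (dist x z) ⟨dist_nonneg, le_rfl⟩
    rw [h1] at this
    rwa [abs_sub_comm, abs_of_pos (sub_pos.2 hz)] at this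
  obtain ⟨ρ, hin, hout⟩ : ∃ ρ : X → X, (∀ z, dist x z ≤ r → ρ z = z) ∧
      ∀ z, r < dist x z → ρ z = f z r :=
    ⟨fun z => if dist x z ≤ r then z else f z r, fun z hz => if_pos hz,
      fun z hz => if_neg hz.not_ge⟩
  have hρ : ∀ z, dist (ρ z) z = max (dist x z - r) 0 := by
    intro z
    rcases le_or_gt (dist x z) r with h | h
    · rw [hin z h, dist_self, max_eq_right (sub_nonpos.2 h)]
    · rw [hout z h, hzf z h, max_eq_left (sub_pos.2 h).le]
  refine ⟨ρ, continuous_iff_continuousAt.2 fun z => ?_, fun z => ?_, hin, fun z hz => ?_⟩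
  · have hb : Continuous fun w => max (dist x w - r) 0 + dist w z := by fun_prop
    rw [ContinuousAt, tendsto_iff_dist_tendsto_zero]
    rcases le_or_gt (dist x z) r with h | h
    · refine squeeze_zero (fun _ => dist_nonneg) (fun w => ?_)
        ((hb.tendsto' z 0) (by simpa using h))
      rw [hin z h, ← hρ w]
      exact dist_triangle _ _ _
    · obtain ⟨E, hE, hE0, H⟩ := exists_bound_dist_geodesic hκ hX hr h
      have hEb : Tendsto (fun w => √(E (max (dist x w - r) 0 + dist w z))) (𝓝 z) (𝓝 0) := by
        refine (Real.continuous_sqrt.comp (hE.comp hb)).tendsto' z 0 ?_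
        simp [max_eq_left (sub_pos.2 h).le, hE0]
      have hev : ∀ᶠ w in 𝓝 z, r < dist x w :=
        (continuous_const.dist continuous_id).continuousAt.eventually_const_lt h
      refine squeeze_zero' (Eventually.of_forall fun _ => dist_nonneg) ?_ hEb
      filter_upwards [hev] with w hw
      refine Real.le_sqrt_of_sq_le ?_
      rw [dist_comm, hout z h]
      refine H x z (ρ w) (f z) rfl (hf z) ((hout w hw).symm ▸ hxf w hw) _ ?_
      rw [← hρ w]
      exact dist_triangle _ _ _
  · rcases le_or_gt (dist x z) r with h | h
    · rwa [hin z h]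
    · rw [hout z h, hxf z h]
  · rcases le_or_gt (dist x z) r with h | h
    · exact hin z h
    · rw [hout z h, hxf z h] at hz
      exact absurd hz (lt_irrefl _)

theorem one_le_sqrt_mul_sqrt_sub (u v : ℝ × ℝ) :
    1 ≤ √(1 + u.1 ^ 2 + u.2 ^ 2) * √(1 + v.1 ^ 2 + v.2 ^ 2) - u.1 * v.1 - u.2 * v.2 := by
  have h : 1 + u.1 * v.1 + u.2 * v.2 ≤ √(1 + u.1 ^ 2 + u.2 ^ 2) * √(1 + v.1 ^ 2 + v.2 ^ 2) := by
    rw [← Real.sqrt_mul (by positivity)]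
    refine Real.le_sqrt_of_sq_le ?_
    nlinarith [sq_nonneg (u.1 - v.1), sq_nonneg (u.2 - v.2),
      sq_nonneg (u.1 * v.2 - u.2 * v.1)]
  linarith

theorem continuous_mDist (κ : ℝ) (u : ℝ × ℝ) : Continuous fun v => mDist κ u v := by
  unfold mDist arcosh
  split_ifs
  · fun_prop
  · refine continuous_const.mul (Continuous.log (by fun_prop) fun v => ?_)
    have := one_le_sqrt_mul_sqrt_sub u v
    positivity

theorem mDist_self (κ : ℝ) (u : ℝ × ℝ) : mDist κ u u = 0 := by
  unfold mDist arcosh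
  split_ifs
  · simp
  · rw [Real.mul_self_sqrt (by positivity)]
    ring_nf
    simp

theorem le_exp_arcosh {e : ℝ} (he : 1 ≤ e) : e ≤ Real.exp (arcosh e) := by
  rw [arcosh, Real.exp_log (by positivity)]
  exact le_add_of_nonneg_right (Real.sqrt_nonneg _)

/-- The Euclidean distance in coordinates is controlled by the distance of the model plane. -/
theorem exists_bound_sq_sub {κ : ℝ} (hκ : κ ≤ 0) (u : ℝ × ℝ) :
    ∃ G : ℝ → ℝ, Continuous G ∧ G 0 = 0 ∧
      ∀ v : ℝ × ℝ, (u.1 - v.1) ^ 2 + (u.2 - v.2) ^ 2 ≤ G (mDist κ u v) := by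
  rcases hκ.eq_or_lt with rfl | hκ
  · refine ⟨fun d => d ^ 2, by fun_prop, by simp, fun v => ?_⟩
    simp only [mDist, if_true]
    rw [Real.sq_sqrt (by positivity)]
  · obtain ⟨a, ha⟩ : ∃ a, a = √(1 + u.1 ^ 2 + u.2 ^ 2) := ⟨_, rfl⟩
    refine ⟨fun d => (Real.exp (√(-κ) * d) - 1) * (4 * a ^ 2 * Real.exp (√(-κ) * d) + 1),
      by fun_prop, by simp, fun v => ?_⟩
    obtain ⟨b, hb⟩ : ∃ b, b = √(1 + v.1 ^ 2 + v.2 ^ 2) := ⟨_, rfl⟩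
    have ha2 : a ^ 2 = 1 + u.1 ^ 2 + u.2 ^ 2 := by rw [ha, Real.sq_sqrt (by positivity)]
    have hb2 : b ^ 2 = 1 + v.1 ^ 2 + v.2 ^ 2 := by rw [hb, Real.sq_sqrt (by positivity)]
    have ha0 : 0 ≤ a := ha ▸ Real.sqrt_nonneg _
    have hb0 : 0 ≤ b := hb ▸ Real.sqrt_nonneg _
    have he1 := one_le_sqrt_mul_sqrt_sub u v
    have hk : √(-κ) ≠ 0 := (Real.sqrt_pos.2 (by linarith)).ne'
    have hd : √(-κ) * mDist κ u v = arcosh (a * b - u.1 * v.1 - u.2 * v.2) := by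
      rw [mDist, if_neg hκ.ne, ← ha, ← hb, ← mul_assoc, mul_one_div_cancel hk, one_mul]
    simp only [hd]
    rw [← ha, ← hb] at he1
    have hexp := le_exp_arcosh he1
    obtain ⟨s, hs⟩ : ∃ s, s = u.1 * v.1 + u.2 * v.2 := ⟨_, rfl⟩
    rw [sub_sub, ← hs] at he1 hexp ⊢
    have hs2 : s ^ 2 ≤ (a ^ 2 - 1) * (b ^ 2 - 1) := by
      rw [hs, ha2, hb2]
      nlinarith [sq_nonneg (u.1 * v.2 - u.2 * v.1)]
    have ha1 : 1 ≤ a ^ 2 := by nlinarith [sq_nonneg u.1, sq_nonneg u.2]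
    have hb1 : 1 ≤ b ^ 2 := by nlinarith [sq_nonneg v.1, sq_nonneg v.2]
    have hsab : s ≤ a * b := by linarith
    have hbe : b ≤ 2 * a * (a * b - s) := by
      have : 2 * a * s ≤ b * (2 * a ^ 2 - 1) := by
        refine le_of_sq_le_sq ?_ (mul_nonneg hb0 (by linarith))
        nlinarith [mul_le_mul_of_nonneg_left hs2 (show 0 ≤ 4 * a ^ 2 by positivity),
          mul_nonneg (sub_nonneg.2 ha1) (sq_nonneg a)]
      nlinarith
    calc (u.1 - v.1) ^ 2 + (u.2 - v.2) ^ 2 ≤ (a * b) ^ 2 - (1 + s) ^ 2 := by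
          rw [mul_pow]
          nlinarith
      _ = (a * b - s - 1) * (a * b + s + 1) := by ring
      _ ≤ (a * b - s - 1) * (4 * a ^ 2 * (a * b - s) + 1) := by
          refine mul_le_mul_of_nonneg_left ?_ (by linarith)
          nlinarith [mul_le_mul_of_nonneg_left hbe ha0]
      _ ≤ _ := by
          gcongr
          linarith

/-- Faces of a polyhedral complex are planar: they have charts in `ℂ`. -/
theorem exists_complex_chart {κ : ℝ} (hκ : κ ≤ 0) {X : Type*} [MetricSpace X]
    (PC : PolyComplex2 κ X) {F : Set X} (hF : F ∈ PC.faces) :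
    ∃ φ : X → ℂ, InjOn φ F ∧ ContinuousOn φ F ∧ ∀ x ∈ F, ∀ U ∈ 𝓝 x, φ '' U ∈ 𝓝 (φ x) := by
  obtain ⟨f, P, -, hinj, -, hFP, hd⟩ := PC.face_chart F hF
  have hd' : ∀ x ∈ F, ∀ y ∈ F, mDist κ (f x) (f y) = dist x y := fun x hx y hy =>
    hd x (subset_closure hx) y (subset_closure hy)
  refine ⟨fun w => Complex.equivRealProdCLM.symm (f w), ?_, ?_, ?_⟩
  · exact Complex.equivRealProdCLM.symm.injective.comp_injOn (hinj.mono subset_closure)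
  · intro x hx
    obtain ⟨G, hG, hG0, H⟩ := exists_bound_sq_sub hκ (f x)
    rw [ContinuousWithinAt, tendsto_iff_dist_tendsto_zero]
    have hlim : Tendsto (fun w => √(G (dist x w))) (𝓝[F] x) (𝓝 0) := by
      refine tendsto_nhdsWithin_of_tendsto_nhds ?_
      refine Continuous.tendsto' (by fun_prop) x 0 ?_
      simp [hG0]
    refine squeeze_zero' (Eventually.of_forall fun _ => dist_nonneg) ?_ hlim
    filter_upwards [self_mem_nhdsWithin] with w hw
    rw [dist_comm, Complex.dist_eq_re_im, ← hd' x hx w hw]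
    exact Real.sqrt_le_sqrt (by simpa using H (f w))
  · intro x hx U hU
    obtain ⟨r, hr, hrU⟩ := Metric.mem_nhds_iff.1 hU
    have h1 : interior P ∩ {v | mDist κ (f x) v < r} ∈ 𝓝 (f x) := by
      refine IsOpen.mem_nhds (isOpen_interior.inter
        (isOpen_lt (continuous_mDist κ _) continuous_const)) ⟨hFP ▸ mem_image_of_mem f hx, ?_⟩
      rw [mem_ofPred, mDist_self]
      exact hr
    refine mem_of_superset
      (Complex.equivRealProdCLM.symm.toHomeomorph.isOpenMap.image_mem_nhds h1) ?_
    rintro _ ⟨v, ⟨hvP, hv⟩, rfl⟩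
    rw [← hFP] at hvP
    obtain ⟨w, hw, rfl⟩ := hvP
    rw [mem_ofPred, hd' x hx w hw] at hv
    exact ⟨w, hrU (by rwa [mem_ball, dist_comm]), rfl⟩

theorem SCC.eq_or_eq_of_toFun_eq {X : Type*} [TopologicalSpace X] (γ : SCC X) {c s t : ℝ}
    (hc : c ∈ Ioo (0 : ℝ) 1) (hs : s ∈ Icc 0 c) (ht : t ∈ Icc c 1)
    (h : γ.toFun s = γ.toFun t) : γ.toFun s = γ.toFun c ∨ γ.toFun s = γ.toFun 0 := by
  rcases ht.2.lt_or_eq with h1 | rfl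
  · have := γ.inj ⟨hs.1, hs.2.trans_lt hc.2⟩ ⟨hc.1.le.trans ht.1, h1⟩ h
    left
    rw [le_antisymm hs.2 (this ▸ ht.1)]
  · exact Or.inr (h.trans γ.loop.symm)

end Cat2Cx

open Cat2Cx in
/-- **Lemma (accumulation_lemma).**  Let `γ` be a simple closed curve in `X` and let `x` be a
point of `γ` lying on a face of `X`.  Then `Int γ` accumulates on `x`. -/
theorem interiorSet_accumulates_at_face_points
    {κ : ℝ} (hκ : κ ≤ 0) {X : Type*} [MetricSpace X]
    (PC : PolyComplex2 κ X) (hX : IsCATSpace κ X)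
    (γ : SCC X) (x : X) (hx : x ∈ γ.img) (hface : ∃ F ∈ PC.faces, x ∈ F) :
    AccPt x (Filter.principal γ.interiorSet) := by
  obtain ⟨F, hF, hxF⟩ := hface
  rw [accPt_iff_nhds]
  intro U hU
  obtain ⟨φ, hinj, hcont, hnhds⟩ := exists_complex_chart hκ PC hF
  obtain ⟨r, hr, hrU⟩ := nhds_basis_closedBall.mem_iff.1
    (inter_mem hU ((PC.faces_open F hF).mem_nhds hxF))
  obtain ⟨ρ, hρ, hρr, hρin, hρball⟩ := exists_continuous_radial_projection hκ hX x hr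
  have hρF : ∀ z, ρ z ∈ F := fun z =>
    (hrU (by rw [mem_closedBall, dist_comm]; exact hρr z)).2
  have hφρ : Continuous fun z => φ (ρ z) := hcont.comp_continuous hρ hρF
  have hρx : ρ x = x := hρin x (by simpa using hr.le)
  have hball : ∀ w ∈ ball x r, ∀ z, φ (ρ z) = φ w → z = w := by
    intro w hw z hz
    rw [mem_ball, dist_comm] at hw
    have hwF : w ∈ F := hρin w hw.le ▸ hρF w
    have h1 := hinj (hρF z) hwF hz
    rw [← h1, hρball z (h1 ▸ hw)]
  have hxr : x ∈ ball x r := mem_ball_self hr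
  obtain ⟨c, hc, hp⟩ : ∃ c ∈ Ioo (0 : ℝ) 1, γ.toFun c = x ∧ γ.toFun 0 ≠ x ∨
      γ.toFun 0 = x ∧ γ.toFun c ≠ x := by
    obtain ⟨t, ht, rfl⟩ := hx
    have hne : ∀ s ∈ Ioo (0 : ℝ) 1, γ.toFun 0 ≠ γ.toFun s := fun s hs h =>
      hs.1.ne (γ.inj ⟨le_rfl, one_pos⟩ ⟨hs.1.le, hs.2⟩ h)
    have hhalf : (1 / 2 : ℝ) ∈ Ioo (0 : ℝ) 1 := by norm_num
    rcases ht.1.eq_or_lt with rfl | h0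
    · exact ⟨1 / 2, hhalf, Or.inr ⟨rfl, (hne _ hhalf).symm⟩⟩
    rcases ht.2.eq_or_lt with rfl | h1
    · exact ⟨1 / 2, hhalf, Or.inr ⟨γ.loop, γ.loop ▸ (hne _ hhalf).symm⟩⟩
    · exact ⟨t, ⟨h0, h1⟩, Or.inl ⟨rfl, hne t ⟨h0, h1⟩⟩⟩
  obtain ⟨y, hy, hyx⟩ : ∃ y, y ≠ x ∧ ∀ s ∈ Icc 0 c, ∀ t ∈ Icc c 1, γ.toFun s = γ.toFun t →
      γ.toFun s = x ∨ γ.toFun s = y := by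
    rcases hp with ⟨h, h'⟩ | ⟨h, h'⟩
    · exact ⟨_, h', fun s hs t ht hst => h ▸ γ.eq_or_eq_of_toFun_eq hc hs ht hst⟩
    · exact ⟨_, h', fun s hs t ht hst => h ▸ (γ.eq_or_eq_of_toFun_eq hc hs ht hst).symm⟩
  have hφy : φ (ρ y) ≠ φ x := fun h => hy (hball x hxr y h)
  obtain ⟨ε, hε, hεsub⟩ := Metric.mem_nhds_iff.1
    (inter_mem (hnhds x hxF _ (ball_mem_nhds x hr)) (isOpen_ne.mem_nhds hφy.symm))
  obtain ⟨z, hz, hzβ, Γ, hΓ, hΓexp, hΓne⟩ := exists_log_change_ne_zero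
    (fun t => φ (ρ (γ.toFun t))) (hφρ.comp_continuousOn γ.contOn) hc (p := φ x)
    (by
      refine hp.imp (fun h => ⟨?_, fun h' => h.2 (hball x hxr _ h')⟩)
        fun h => ⟨?_, fun h' => h.2 (hball x hxr _ h')⟩ <;> simp only [h.1, hρx])
    (by simp only [γ.loop]) hε
    (by
      intro s hs t ht hst hmem
      obtain ⟨⟨w, hw, hwφ⟩, hne⟩ := hεsub hmem
      have hsw := hball w hw _ hwφ.symm
      have htw := hball w hw _ (hst.symm.trans hwφ.symm)
      rcases hyx s hs t ht (hsw.trans htw.symm) with h | h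
      · simp only [h, hρx]
      · exact absurd (by simp only [h]) hne)
  obtain ⟨⟨w, hw, rfl⟩, -⟩ := hεsub hz
  have hρw : ρ w = w := hρin w (by rw [dist_comm]; exact (mem_ball.1 hw).le)
  have hwγ : w ∉ γ.img := by
    rintro ⟨t, ht, rfl⟩
    exact hzβ ⟨t, ht, by simp only [hρw]⟩
  refine ⟨w, ⟨(hrU (ball_subset_closedBall hw)).1, hwγ, fun hnull => ?_⟩,
    fun h => hwγ (h ▸ hx)⟩
  have hsub : γ.img ⊆ {w}ᶜ := fun a ha h => hwγ (h ▸ ha)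
  refine hΓne (log_closed_of_loopClassH1_eq_one (γ.pathIn _ hsub) (hnull hsub)
    (fun b => φ (ρ b) - φ w) ((hφρ.comp continuous_subtype_val).sub continuous_const)
    (fun b hb => b.2 ?_) Γ hΓ hΓexp)
  exact hball w hw b (sub_eq_zero.1 hb)
end

section
/- Let γ be a simple closed curve in X. Then every point of γ is an accumulation point of Int γ; in fact, every point of γ is an accumulation point of the set of points of Int γ that lie on faces of X. -/
open Set Metric Filter

section

open scoped unitInterval Topology

namespace Cat2Cx

/-- The closed path `p` in `ℂ \ {0}` has a continuous logarithm that is again closed. -/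
def HasClosedLog (p : I → ℂ) : Prop :=
  ∃ θ : C(I, ℂ), (∀ t, Complex.exp (θ t) = p t) ∧ θ 0 = θ 1

lemma HasClosedLog.mul {p q : I → ℂ} (hp : HasClosedLog p) (hq : HasClosedLog q) :
    HasClosedLog (fun t => p t * q t) := by
  obtain ⟨θ, h, h'⟩ := hp
  obtain ⟨η, k, k'⟩ := hq
  exact ⟨θ + η, fun t => by simp [Complex.exp_add, h, k], by simp [h', k']⟩

lemma HasClosedLog.conj {p : I → ℂ} (hp : HasClosedLog p) :
    HasClosedLog (fun t => (starRingEnd ℂ) (p t)) := by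
  obtain ⟨θ, h, h'⟩ := hp
  exact ⟨⟨fun t => (starRingEnd ℂ) (θ t), by fun_prop⟩,
    fun t => by simp [Complex.exp_conj, h], by simp [h']⟩

/-- A continuous map from a preconnected space with constant exponential is constant. -/
lemma eq_of_exp_comp_const {A : Type*} [TopologicalSpace A] [PreconnectedSpace A] {u : A → ℂ}
    (hu : Continuous u) (w : ℂ) (h : ∀ a, Complex.exp (u a) = w) (a b : A) : u a = u b := by
  have := Complex.isCoveringMap_exp.eq_of_comp_eq hu (continuous_const (y := u a))
    (by ext a'; simp [h]) a rfl
  exact (congrFun this b).symm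

/-- The end of a homotopy of closed paths in `ℂ \ {0}` starting at a constant path has a closed
logarithm. -/
lemma hasClosedLog_of_homotopy (Φ : C(I × I, ℂ)) (h0 : ∀ z, Φ z ≠ 0)
    (hloop : ∀ s, Φ (s, 0) = Φ (s, 1)) (hconst : ∀ t, Φ (0, t) = Φ (0, 0)) :
    HasClosedLog (fun t => Φ (1, t)) := by
  let Φ' : C(I × I, {z : ℂ // z ≠ 0}) := ⟨fun z => ⟨Φ z, h0 z⟩, by fun_prop⟩
  let F := Complex.isCoveringMap_exp.liftHomotopy Φ'
    (ContinuousMap.const I (Complex.log (Φ (0, 0))))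
    (fun t => Subtype.ext (by simp [Φ', hconst t, Complex.exp_log (h0 _)]))
  have hF' : ∀ z, Complex.exp (F z) = Φ z := fun z =>
    congrArg Subtype.val (congrFun (Complex.isCoveringMap_exp.liftHomotopy_lifts Φ' _ _) z)
  refine ⟨⟨fun t => F (1, t), by fun_prop⟩, fun t => hF' _, ?_⟩
  have e0 : ∀ t, F (0, t) = Complex.log (Φ (0, 0)) := fun t =>
    Complex.isCoveringMap_exp.liftHomotopy_zero Φ' _ _ t
  have e1 : F (0, 0) = F (0, 1) := (e0 0).trans (e0 1).symm
  have e2 := eq_of_exp_comp_const (u := fun s : I => F (s, 0) - F (s, 1))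
    (by fun_prop) 1 (fun s => by
      rw [Complex.exp_sub, hF', hF', hloop, div_self (h0 _)]) 0 1
  simp only [e1, sub_self] at e2
  exact sub_eq_zero.mp e2.symm

/-- A map to `ℂ \ {0}` composed with a nullhomologous loop has a closed logarithm. -/
lemma hasClosedLog_of_loopClassH1_eq_one {B : Type*} [TopologicalSpace B] {x : B} (p : Path x x)
    (hp : loopClassH1 p = 1) (R : C(B, ℂ)) (hR : ∀ b, R b ≠ 0) :
    HasClosedLog (fun t => R (p t)) := by
  let R' : C(B, {z : ℂ // z ≠ 0}) := ⟨fun b => ⟨R b, hR b⟩, by fun_prop⟩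
  let e : (fun z : ℂ ↦ (⟨_, z.exp_ne_zero⟩ : {z : ℂ // z ≠ 0})) ⁻¹' {R' x} :=
    ⟨Complex.log (R x), by simp [R', Complex.exp_log (hR x)]⟩
  let T := (Complex.isAddQuotientCoveringMap_exp.fundamentalGroupToMulOpposite e).comp
    (FundamentalGroup.map R' x)
  have h1 : T (FundamentalGroup.fromPath ⟦p⟧) = 1 := by
    have : Abelianization.lift T (loopClassH1 p) = 1 := by rw [hp, map_one]
    rw [loopClassH1] at this
    erw [Abelianization.lift_apply_of] at this
    exact this
  have h2 := Complex.isAddQuotientCoveringMap_exp.fundamentalGroupToMulOpposite_eq_one_iff.mp h1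
  let q : C(I, {z : ℂ // z ≠ 0}) := (p.map R'.continuous).toContinuousMap
  have hq : q 0 = (fun z : ℂ ↦ (⟨_, z.exp_ne_zero⟩ : {z : ℂ // z ≠ 0})) e.1 :=
    ((p.map R'.continuous).source).trans e.2.symm
  refine ⟨Complex.isCoveringMap_exp.liftPath q e.1 hq, fun t => ?_, ?_⟩
  · exact congrArg Subtype.val (congrFun (Complex.isCoveringMap_exp.liftPath_lifts q e.1 hq) t)
  · rw [Complex.isCoveringMap_exp.liftPath_zero]
    exact (congrArg Subtype.val h2).symm

lemma SCC.hasClosedLog_of_nullhomologousIn {X : Type*} [TopologicalSpace X] (γ : SCC X) (d : X)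
    (hd : d ∉ γ.img) (hn : γ.NullhomologousIn {d}ᶜ) (R : C(X, ℂ)) (hR : ∀ z, z ≠ d → R z ≠ 0) :
    HasClosedLog (fun t : I => R (γ.toFun t)) := by
  have h : γ.img ⊆ {d}ᶜ := fun z hz hzd => hd (hzd ▸ hz)
  exact hasClosedLog_of_loopClassH1_eq_one (γ.pathIn {d}ᶜ h) (hn h)
    ⟨fun z : ({d}ᶜ : Set X) => R z, by fun_prop⟩ (fun b => hR b b.2)

variable {X : Type*} [MetricSpace X]

/-- The zero `d` of `H` can be divided out: near `d`, up to a nonvanishing factor with a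
logarithm, `H` agrees with a map vanishing only at `d` whose restriction to the path `p` has a
closed logarithm. -/
def RemovableZero (p : I → X) (H : X → ℂ) (d : X) : Prop :=
  ∃ R : C(X, ℂ), (∀ z, R z = 0 ↔ z = d) ∧ HasClosedLog (fun t => R (p t)) ∧
    ∃ φ : X → ℂ, ∃ N ∈ 𝓝 d, ContinuousOn φ (N \ {d}) ∧
      ∀ z ∈ N \ {d}, H z = Complex.exp (φ z) * R z

/-- A nonvanishing germ has a logarithm. -/
lemma exists_local_log {X : Type*} [TopologicalSpace X] (R : C(X, ℂ)) {d : X} (hd : R d ≠ 0) :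
    ∃ l : X → ℂ, ∃ N ∈ 𝓝 d, ContinuousOn l N ∧ ∀ z ∈ N, R z = Complex.exp (l z) := by
  have hN : {z | R z / R d ∈ Complex.slitPlane} ∈ 𝓝 d := by
    have hc : Continuous fun z => R z / R d := by fun_prop
    refine hc.continuousAt (Complex.isOpen_slitPlane.mem_nhds ?_)
    simp [div_self hd]
  refine ⟨fun z => Complex.log (R z / R d) + Complex.log (R d), _, hN, ?_, fun z hz => ?_⟩
  · refine ContinuousOn.add (ContinuousOn.clog (by fun_prop) fun z hz => hz) continuousOn_const
  · have : R z / R d ≠ 0 := Complex.slitPlane_ne_zero hz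
    rw [Complex.exp_add, Complex.exp_log this, Complex.exp_log hd, div_mul_cancel₀ _ hd]

lemma RemovableZero.congr_mul {p : I → X} {H H' : X → ℂ} {d : X} (h : RemovableZero p H d)
    (u : C(X, ℂ)) (hu : u d ≠ 0) (hH : ∀ᶠ z in 𝓝 d, H z = H' z * u z) :
    RemovableZero p H' d := by
  obtain ⟨R, hR, hRl, φ, N, hN, hφ, hHR⟩ := h
  obtain ⟨l, N', hN', hl, hul⟩ := exists_local_log u hu
  refine ⟨R, hR, hRl, fun z => φ z - l z, N ∩ (N' ∩ {z | H z = H' z * u z}),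
    inter_mem hN (inter_mem hN' hH), ?_, ?_⟩
  · exact (hφ.mono fun z hz => ⟨hz.1.1, hz.2⟩).sub (hl.mono fun z hz => hz.1.2.1)
  · rintro z ⟨⟨h1, h2, h3⟩, h4⟩
    have h5 := hHR z ⟨h1, h4⟩
    rw [mem_ofPred_eq] at h3
    have h6 := hul z h2
    have h7 : Complex.exp (l z) ≠ 0 := Complex.exp_ne_zero _
    rw [Complex.exp_sub, div_mul_eq_mul_div, eq_div_iff h7, ← h6, ← h3, h5]

/-- Dividing out one removable zero. -/
lemma exists_divide_removableZero {p : I → X} (hp : Continuous p) (H : C(X, ℂ)) {d : X}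
    (hpd : ∀ t, p t ≠ d) (hd : RemovableZero p H d) :
    ∃ H' : C(X, ℂ), (∀ z, H' z = 0 ↔ H z = 0 ∧ z ≠ d) ∧
      (HasClosedLog (fun t => H' (p t)) → HasClosedLog (fun t => H (p t))) ∧
      ∀ d', d' ≠ d → H d' = 0 → RemovableZero p H d' → RemovableZero p H' d' := by
  obtain ⟨R, hR, hRl, φ, N, hN, hφ, hHR⟩ := hd
  obtain ⟨r₁, hr₁, hb₁⟩ := Metric.mem_nhds_iff.mp hN
  have hcl : IsClosed (range p) := (isCompact_range hp).isClosed
  obtain ⟨r₂, hr₂, hb₂⟩ := Metric.mem_nhds_iff.mp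
    (hcl.isOpen_compl.mem_nhds (show d ∈ (range p)ᶜ by rintro ⟨t, ht⟩; exact hpd t ht))
  obtain ⟨r, hr, hrN, hrp⟩ : ∃ r > 0, ball d r ⊆ N ∧ ∀ t, r ≤ dist (p t) d := by
    refine ⟨min r₁ r₂, lt_min hr₁ hr₂, (ball_subset_ball (min_le_left _ _)).trans hb₁, fun t => ?_⟩
    by_contra! h
    exact hb₂ (mem_ball.mpr (h.trans_le (min_le_right _ _))) ⟨t, rfl⟩
  let χ : X → ℝ := fun z => max 0 (min 1 (3 * dist z d / r - 1))
  have hχ : Continuous χ := by fun_prop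
  have hχ0 : ∀ z, dist z d ≤ r / 3 → χ z = 0 := fun z hz => by
    have : 3 * dist z d / r ≤ 1 := by rw [div_le_one hr]; linarith
    exact max_eq_left ((min_le_right _ _).trans (by linarith))
  have hχ1 : ∀ z, 2 * r / 3 ≤ dist z d → χ z = 1 := fun z hz => by
    have : 2 ≤ 3 * dist z d / r := by rw [le_div_iff₀ hr]; linarith
    simp only [χ]
    rw [min_eq_left (by linarith)]
    simp
  classical
  let G : X → ℂ := fun z => if dist z d < r then Complex.exp (χ z * φ z) else H z / R z
  have hGin : ∀ z, dist z d < r → G z = Complex.exp (χ z * φ z) := fun z hz => if_pos hz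
  have hGout : ∀ z, 2 * r / 3 ≤ dist z d → G z = H z / R z := fun z hz => by
    by_cases h : dist z d < r
    · have hzd : z ≠ d := by rintro rfl; rw [dist_self] at hz; linarith
      rw [hGin z h, hχ1 z hz, hHR z ⟨hrN h, hzd⟩, Complex.ofReal_one, one_mul,
        mul_div_cancel_right₀ _ (mt (hR z).mp hzd)]
    · exact if_neg h
  have hGc : Continuous G := by
    rw [continuous_iff_continuousAt]
    intro z
    rcases lt_or_ge (dist z d) (r / 3) with h | h
    · have : G =ᶠ[𝓝 z] fun _ => 1 := by
        filter_upwards [isOpen_ball.mem_nhds (show z ∈ ball d (r / 3) from h)] with w hw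
        rw [hGin w (by rw [mem_ball] at hw; linarith), hχ0 w (le_of_lt hw)]
        simp
      exact continuousAt_const.congr this.symm
    rcases lt_or_ge (dist z d) r with h' | h'
    · have hzd : z ≠ d := by rintro rfl; rw [dist_self] at h; linarith
      have hO : ball d r \ {d} ∈ 𝓝 z := (isOpen_ball.sdiff isClosed_singleton).mem_nhds ⟨h', hzd⟩
      have hφz : ContinuousAt φ z :=
        (hφ.mono fun w hw => ⟨hrN hw.1, hw.2⟩).continuousAt hO
      have : G =ᶠ[𝓝 z] fun w => Complex.exp (χ w * φ w) := by
        filter_upwards [hO] with w hw using hGin w hw.1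
      refine ContinuousAt.congr ?_ this.symm
      exact Complex.continuous_exp.continuousAt.comp
        ((Complex.continuous_ofReal.comp hχ).continuousAt.mul hφz)
    · have hzd : z ≠ d := by rintro rfl; rw [dist_self] at h'; linarith
      have : G =ᶠ[𝓝 z] fun w => H w / R w := by
        have ho : IsOpen {w | 2 * r / 3 < dist w d} := isOpen_lt continuous_const (by fun_prop)
        filter_upwards [ho.mem_nhds (show 2 * r / 3 < dist z d by linarith)] with w hw
          using hGout w (le_of_lt hw)
      refine ContinuousAt.congr ?_ this.symm
      exact H.continuous.continuousAt.div R.continuous.continuousAt (mt (hR z).mp hzd)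
  refine ⟨⟨G, hGc⟩, fun z => ?_, fun hl => ?_, fun d' hd' hHd' hrem => ?_⟩
  · change G z = 0 ↔ _
    rcases lt_or_ge (dist z d) r with h | h
    · rw [hGin z h]
      refine ⟨fun h => absurd h (Complex.exp_ne_zero _), fun ⟨h1, h2⟩ => ?_⟩
      rw [hHR z ⟨hrN h, h2⟩] at h1
      exact absurd h1 (mul_ne_zero (Complex.exp_ne_zero _) (mt (hR z).mp h2))
    · have hzd : z ≠ d := by rintro rfl; rw [dist_self] at h; linarith
      rw [hGout z (by linarith), div_eq_zero_iff]
      simp [hR, hzd]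
  · refine (hl.mul hRl).imp fun θ hθ => ⟨fun t => ?_, hθ.2⟩
    rw [hθ.1 t]
    change G (p t) * _ = _
    rw [hGout _ (by linarith [hrp t]), div_mul_cancel₀ _ (mt (hR _).mp (hpd t))]
  · refine hrem.congr_mul R (mt (hR _).mp hd') ?_
    have h' : r ≤ dist d' d := by
      by_contra! h
      rw [hHR d' ⟨hrN h, hd'⟩] at hHd'
      exact mul_ne_zero (Complex.exp_ne_zero _) (mt (hR _).mp hd') hHd'
    have ho : IsOpen {w | 2 * r / 3 < dist w d} := isOpen_lt continuous_const (by fun_prop)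
    filter_upwards [ho.mem_nhds (show 2 * r / 3 < dist d' d by linarith)] with w hw
    have hwd : w ≠ d := by rintro rfl; rw [dist_self] at hw; linarith
    change _ = G w * _
    rw [hGout w (le_of_lt hw), div_mul_cancel₀ _ (mt (hR _).mp hwd)]

lemma RemovableZero.eventually_ne {p : I → X} {H : X → ℂ} {d : X} (h : RemovableZero p H d) :
    ∀ᶠ z in 𝓝 d, z ≠ d → H z ≠ 0 := by
  obtain ⟨R, hR, -, φ, N, hN, -, hHR⟩ := h
  filter_upwards [hN] with z hz hzd
  rw [hHR z ⟨hz, hzd⟩]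
  exact mul_ne_zero (Complex.exp_ne_zero _) (mt (hR z).mp hzd)

/-- If all zeros of `H` met by a nullhomotopy of the loop `Φ (1, ·)` are removable, then `H` has a
closed logarithm along the loop. -/
lemma hasClosedLog_of_removableZeros (Φ : C(I × I, X)) (hloop : ∀ s, Φ (s, 0) = Φ (s, 1))
    (hconst : ∀ t, Φ (0, t) = Φ (0, 0)) (H : C(X, ℂ)) (hH : ∀ t, H (Φ (1, t)) ≠ 0)
    (hrem : ∀ d, H d = 0 → RemovableZero (fun t => Φ (1, t)) H d) :
    HasClosedLog (fun t => H (Φ (1, t))) := by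
  have hfin : (range Φ ∩ {z | H z = 0}).Finite := by
    have hc : IsCompact (range Φ ∩ {z | H z = 0}) :=
      (isCompact_range Φ.continuous).inter_right (isClosed_eq H.continuous continuous_const)
    refine hc.finite (isDiscrete_iff_discreteTopology.mpr ?_)
    rw [discreteTopology_subtype_iff]
    rintro d ⟨-, hd⟩
    rw [← disjoint_iff, Filter.disjoint_principal_right]
    refine mem_nhdsWithin.mpr ?_
    obtain ⟨U, hU, hUo, hdU⟩ := _root_.eventually_nhds_iff.mp (hrem d hd).eventually_ne
    exact ⟨U, hUo, hdU, fun z hz hz' => hU z hz.1 hz.2 hz'.2⟩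
  generalize hn : (range Φ ∩ {z | H z = 0}).ncard = n
  induction n generalizing H with
  | zero =>
    rw [Set.ncard_eq_zero hfin] at hn
    exact hasClosedLog_of_homotopy (H.comp Φ)
      (fun z hz => (hn ▸ (⟨⟨z, rfl⟩, hz⟩ : Φ z ∈ range Φ ∩ {z | H z = 0}) : Φ z ∈ (∅ : Set X)))
      (fun s => by simp [hloop]) (fun t => by simp [hconst t])
  | succ n ih =>
    obtain ⟨d, hd⟩ : (range Φ ∩ {z | H z = 0}).Nonempty := by
      rw [← Set.ncard_pos hfin, hn]; omega
    obtain ⟨H', hz, hl, hr⟩ := exists_divide_removableZero (p := fun t => Φ (1, t)) (by fun_prop) H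
      (fun t ht => hH t (by rw [ht]; exact hd.2)) (hrem d hd.2)
    have hset : range Φ ∩ {z | H' z = 0} = (range Φ ∩ {z | H z = 0}) \ {d} := by
      ext z; simp [hz, and_assoc]
    refine hl (ih H' (fun t ht => hH t ((hz _).mp ht).1)
      (fun d' hd' => hr d' ((hz _).mp hd').2 ((hz _).mp hd').1 (hrem d' ((hz _).mp hd').1)) ?_ ?_)
    · rw [hset]; exact hfin.sdiff
    · rw [hset, Set.ncard_sdiff_singleton_of_mem hd, hn]; rfl

end Cat2Cx

end

section

open scoped Topology

namespace Cat2Cx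

/-- Convexity of `w ↦ cosh √w`. -/
lemma cosh_le_of_sq_eq {a b c l m : ℝ} (hl : 0 ≤ l) (hm : 0 ≤ m) (hlm : l + m = 1)
    (hc : c ^ 2 = l * a ^ 2 + m * b ^ 2) :
    Real.cosh c ≤ l * Real.cosh a + m * Real.cosh b := by
  refine hasSum_le (fun n => ?_) (Real.hasSum_cosh c)
    (((Real.hasSum_cosh a).mul_left l).add ((Real.hasSum_cosh b).mul_left m))
  have h := (convexOn_pow n).2 (mem_Ici.mpr (sq_nonneg a)) (mem_Ici.mpr (sq_nonneg b)) hl hm hlm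
  simp only [smul_eq_mul, ← hc] at h
  simp only [pow_mul, ← mul_div_assoc, ← add_div]
  gcongr

/-- Angles of hyperbolic comparison triangles are at most the Euclidean ones. -/
lemma cosine_le_hyperbolic_cosine {a b c : ℝ} (ha : 0 < a) (hb : 0 < b) (h1 : |a - b| ≤ c)
    (h2 : c ≤ a + b) :
    (a ^ 2 + b ^ 2 - c ^ 2) / (2 * a * b) ≤
      (Real.cosh a * Real.cosh b - Real.cosh c) / (Real.sinh a * Real.sinh b) := by
  have hab : 0 < 4 * a * b := by positivity
  have hc0 : 0 ≤ c := (abs_nonneg _).trans h1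
  have h1' : (a - b) ^ 2 ≤ c ^ 2 := by rw [← sq_abs (a - b)]; gcongr
  have h2' : c ^ 2 ≤ (a + b) ^ 2 := by gcongr
  have key := cosh_le_of_sq_eq (a := a - b) (b := a + b) (c := c)
    (l := ((a + b) ^ 2 - c ^ 2) / (4 * a * b)) (m := (c ^ 2 - (a - b) ^ 2) / (4 * a * b))
    (div_nonneg (by linarith) hab.le) (div_nonneg (by linarith) hab.le)
    (by field_simp; ring) (by field_simp; ring)
  have hs : 0 < Real.sinh a * Real.sinh b :=
    mul_pos (Real.sinh_pos_iff.mpr ha) (Real.sinh_pos_iff.mpr hb)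
  rw [le_div_iff₀ hs]
  rw [Real.cosh_add, Real.cosh_sub] at key
  have e : (a ^ 2 + b ^ 2 - c ^ 2) / (2 * a * b) =
    ((a + b) ^ 2 - c ^ 2) / (4 * a * b) - (c ^ 2 - (a - b) ^ 2) / (4 * a * b) := by
    field_simp; ring
  have e' : ((a + b) ^ 2 - c ^ 2) / (4 * a * b) + (c ^ 2 - (a - b) ^ 2) / (4 * a * b) = 1 := by
    field_simp; ring
  rw [e]
  generalize ((a + b) ^ 2 - c ^ 2) / (4 * a * b) = l at *
  generalize (c ^ 2 - (a - b) ^ 2) / (4 * a * b) = m at *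
  obtain rfl : m = 1 - l := by linarith
  nlinarith

lemma compAngle_le_euclCompAngle {κ a b c : ℝ} (hκ : κ ≤ 0) (ha : 0 < a) (hb : 0 < b)
    (h1 : |a - b| ≤ c) (h2 : c ≤ a + b) : compAngle κ a b c ≤ euclCompAngle a b c := by
  unfold compAngle
  split_ifs with h
  · exact le_rfl
  have hk : 0 < Real.sqrt (-κ) := Real.sqrt_pos.mpr (by have := lt_of_le_of_ne hκ h; linarith)
  generalize Real.sqrt (-κ) = k at *
  refine Real.antitone_arccos ?_
  have := cosine_le_hyperbolic_cosine (a := k * a) (b := k * b) (c := k * c) (by positivity)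
    (by positivity) (by rw [← mul_sub, abs_mul, abs_of_pos hk]; gcongr) (by nlinarith)
  refine le_trans (le_of_eq ?_) this
  field_simp

lemma cos_lt_of_arccos_lt {x b : ℝ} (hb : b ≤ Real.pi) (h : Real.arccos x < b) :
    Real.cos b < x := by
  have hx : -1 < x := by
    by_contra! h'
    rw [Real.arccos_of_le_neg_one h'] at h
    linarith
  have h1 := Real.cos_lt_cos_of_nonneg_of_le_pi (Real.arccos_nonneg x) hb h
  rcases le_total x 1 with hx1 | hx1
  · rwa [Real.cos_arccos hx.le hx1] at h1
  · exact h1.trans_le ((Real.cos_le_one _).trans hx1)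

variable {X : Type*} [MetricSpace X]

/-- Near the vertex, the comparison angles of two paths are controlled by their upper angle. -/
lemma exists_sq_dist_le_of_upperAngleWrt_lt {m : X} {σ τ : ℝ → X} {b : ℝ} (hb : b ≤ Real.pi)
    (h : upperAngleWrt (fun x y : X => dist x y) m σ τ < b) :
    ∃ ε > 0, ∀ s t, 0 < s → s < ε → 0 < t → t < ε → 0 < dist m (σ s) → 0 < dist m (τ t) →
      dist (σ s) (τ t) ^ 2 ≤ dist m (σ s) ^ 2 + dist m (τ t) ^ 2 -
        2 * dist m (σ s) * dist m (τ t) * Real.cos b := by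
  unfold upperAngleWrt at h
  obtain ⟨_, ⟨ε, hε, rfl⟩, hlt⟩ := exists_lt_of_csInf_lt (by exact ⟨_, 1, one_pos, rfl⟩) h
  refine ⟨ε, hε, fun s t hs hsε ht htε h1 h2 => ?_⟩
  have hbdd : BddAbove {b | ∃ s t : ℝ, 0 < s ∧ s < ε ∧ 0 < t ∧ t < ε ∧
      b = euclCompAngle (dist m (σ s)) (dist m (τ t)) (dist (σ s) (τ t))} :=
    ⟨Real.pi, by rintro _ ⟨_, _, _, _, _, _, rfl⟩; exact Real.arccos_le_pi _⟩
  have hle := le_csSup hbdd ⟨s, t, hs, hsε, ht, htε, rfl⟩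
  have := cos_lt_of_arccos_lt hb (hle.trans_lt hlt)
  rw [lt_div_iff₀ (by positivity)] at this
  linarith

/-- Two adjacent upper angles along a geodesic have nonpositive sum of cosines. -/
lemma cos_add_cos_nonpos_of_upperAngleWrt_le {m : X} {π σ τ : ℝ → X} {l α β : ℝ} (hl : 0 < l)
    (hπ : ∀ s, 0 ≤ s → s ≤ l → dist m (π s) = s) (hσ : ∀ s, 0 ≤ s → s ≤ l → dist m (σ s) = s)
    (hτ : ∀ s, 0 ≤ s → s ≤ l → dist m (τ s) = s)
    (hστ : ∀ s, 0 ≤ s → s ≤ l → dist (σ s) (τ s) = 2 * s)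
    (hαπ : α ≤ Real.pi) (hβπ : β ≤ Real.pi)
    (hα : upperAngleWrt (fun x y : X => dist x y) m π σ ≤ α)
    (hβ : upperAngleWrt (fun x y : X => dist x y) m π τ ≤ β) :
    Real.cos α + Real.cos β ≤ 0 := by
  by_contra! hpos
  have hα' : α < Real.pi := lt_of_le_of_ne hαπ fun h => by
    rw [h, Real.cos_pi] at hpos; linarith [Real.cos_le_one β]
  have hβ' : β < Real.pi := lt_of_le_of_ne hβπ fun h => by
    rw [h, Real.cos_pi] at hpos; linarith [Real.cos_le_one α]
  obtain ⟨δ, hδ, hδα, hδβ, hδpos⟩ : ∃ δ > 0, α + δ < Real.pi ∧ β + δ < Real.pi ∧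
      0 < Real.cos (α + δ) + Real.cos (β + δ) := by
    have hev : ∀ᶠ δ in 𝓝 (0 : ℝ), α + δ < Real.pi ∧ β + δ < Real.pi ∧
        0 < Real.cos (α + δ) + Real.cos (β + δ) := by
      refine ((Continuous.tendsto' (by fun_prop) 0 α (by simp)).eventually_lt_const hα').and
        (((Continuous.tendsto' (by fun_prop) 0 β (by simp)).eventually_lt_const hβ').and ?_)
      exact (Continuous.tendsto' (by fun_prop) 0 (Real.cos α + Real.cos β)
        (by simp)).eventually_const_lt hpos
    obtain ⟨δ, h, hδ⟩ := ((hev.filter_mono nhdsWithin_le_nhds).and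
      (self_mem_nhdsWithin (s := Ioi (0 : ℝ)))).exists
    exact ⟨δ, hδ, h⟩
  obtain ⟨ε₁, hε₁, h₁⟩ := exists_sq_dist_le_of_upperAngleWrt_lt hδα.le (hα.trans_lt (by linarith))
  obtain ⟨ε₂, hε₂, h₂⟩ := exists_sq_dist_le_of_upperAngleWrt_lt hδβ.le (hβ.trans_lt (by linarith))
  have hA := Real.cos_le_one (α + δ)
  have hB := Real.cos_le_one (β + δ)
  generalize Real.cos (α + δ) = A at *
  generalize Real.cos (β + δ) = B at *
  obtain ⟨s, hs, hs1, hs2, hsl⟩ : ∃ s > 0, s < ε₁ ∧ s < ε₂ ∧ s ≤ l := by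
    refine ⟨min (min ε₁ ε₂) l / 2, by positivity, ?_, ?_, ?_⟩ <;>
    linarith [min_le_left (min ε₁ ε₂) l, min_le_right (min ε₁ ε₂) l, min_le_left ε₁ ε₂,
      min_le_right ε₁ ε₂, lt_min (lt_min hε₁ hε₂) hl]
  obtain ⟨u, hu, hus, huAB⟩ : ∃ u > 0, u ≤ s ∧ u < s * (A + B) :=
    ⟨min s (s * (A + B) / 2), by positivity, min_le_left _ _,
      (min_le_right _ _).trans_lt (by nlinarith [mul_pos hs hδpos])⟩
  have e1 := hπ u hu.le (hus.trans hsl)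
  have e2 := hσ s hs.le hsl
  have e3 := hτ s hs.le hsl
  have k1 := h₁ u s hu (by linarith) hs hs1 (by linarith) (by linarith)
  have k2 := h₂ u s hu (by linarith) hs hs2 (by linarith) (by linarith)
  rw [e1, e2] at k1
  rw [e1, e3] at k2
  have bound : ∀ x C : ℝ, C ≤ 1 → x ^ 2 ≤ u ^ 2 + s ^ 2 - 2 * u * s * C →
      x ≤ s - u * C + u ^ 2 / (2 * s) := by
    intro x C hC hx
    refine le_of_sq_le_sq (hx.trans ?_) ?_
    · have : (s - u * C + u ^ 2 / (2 * s)) ^ 2 =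
        u ^ 2 + s ^ 2 - 2 * u * s * C + (u * C - u ^ 2 / (2 * s)) ^ 2 := by
        field_simp; ring
      rw [this]
      nlinarith [sq_nonneg (u * C - u ^ 2 / (2 * s))]
    · have : 0 ≤ u ^ 2 / (2 * s) := by positivity
      nlinarith
  have b1 := bound _ A hA k1
  have b2 := bound _ B hB k2
  have tri := dist_triangle_left (σ s) (τ s) (π u)
  rw [hστ s hs.le hsl] at tri
  have : u ^ 2 / (2 * s) + u ^ 2 / (2 * s) = u * (u / s) := by field_simp; ring
  have : u / s < A + B := by rw [div_lt_iff₀ hs]; linarith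
  nlinarith

/-- The CN inequality of Bruhat and Tits. -/
lemma IsCATSpace.sq_dist_le {κ : ℝ} (hκ : κ ≤ 0) (hX : IsCATSpace κ X) {f : ℝ → X} {q r : X}
    (hf : IsGeodesicFromTo (fun x y : X => dist x y) univ f q r) (p : X) {s : ℝ} (hs0 : 0 ≤ s)
    (hs1 : s ≤ 1) :
    dist p (f (s * dist q r)) ^ 2 ≤
      (1 - s) * dist p q ^ 2 + s * dist p r ^ 2 - s * (1 - s) * dist q r ^ 2 := by
  obtain ⟨hf0, hf1, ⟨-, hfd⟩, -⟩ := hf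
  simp only at hf1 hfd
  have hD := dist_nonneg (x := q) (y := r)
  generalize hDe : dist q r = D at *
  rcases hs0.eq_or_lt with rfl | hs0
  · simp [hf0]
  rcases hs1.eq_or_lt with rfl | hs1
  · simp [hf1]
  rcases hD.eq_or_lt with rfl | hD
  · obtain rfl : q = r := dist_eq_zero.mp hDe
    simp only [mul_zero, hf0]
    linarith
  have ha : 0 < s * D := by positivity
  have hb : 0 < (1 - s) * D := mul_pos (by linarith) hD
  have haD : s * D + (1 - s) * D = D := by ring
  set a := s * D
  set b := (1 - s) * D
  have hmq : dist (f a) q = a := by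
    have := hfd a ⟨ha.le, by linarith⟩ 0 ⟨le_rfl, hD.le⟩
    rwa [hf0, sub_zero, abs_of_pos ha] at this
  have hmr : dist (f a) r = b := by
    have := hfd a ⟨ha.le, by linarith⟩ D ⟨hD.le, le_rfl⟩
    rw [hf1, abs_sub_comm, abs_of_nonneg (by linarith)] at this
    linarith
  by_cases hpq : p = q
  · subst hpq
    rw [dist_comm, hmq, hDe, dist_self]
    simp only [a]; nlinarith
  by_cases hpr : p = r
  · subst hpr
    rw [dist_comm, hmr, dist_comm, hDe, dist_self]
    simp only [b]; nlinarith
  have hmq' : f a ≠ q := fun h => by rw [h, dist_self] at hmq; linarith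
  have hmr' : f a ≠ r := fun h => by rw [h, dist_self] at hmr; linarith
  by_cases hpm : f a = p
  · subst hpm
    rw [hmq, hmr, dist_self]
    simp only [a, b]
    nlinarith [mul_pos (mul_pos hs0 (sub_pos.mpr hs1)) (mul_pos hD hD)]
  obtain ⟨g, hg⟩ := hX.1 (f a) trivial p trivial
  have hh : 0 < dist (f a) p := dist_pos.mpr hpm
  have hσ : IsGeodesicFromTo (fun x y : X => dist x y) univ (fun t => f (a - t)) (f a) q := by
    refine ⟨by simp, by simp [hmq, hf0], ⟨dist_nonneg, ?_⟩, fun _ _ => trivial⟩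
    intro u hu v hv
    simp only [hmq] at hu hv ⊢
    rw [hfd _ ⟨by linarith [hu.2], by linarith [hu.1]⟩ _ ⟨by linarith [hv.2], by linarith [hv.1]⟩,
      abs_sub_comm]
    congr 1; ring
  have hτ : IsGeodesicFromTo (fun x y : X => dist x y) univ (fun t => f (a + t)) (f a) r := by
    refine ⟨by simp, by simp [hmr, haD, hf1], ⟨dist_nonneg, ?_⟩, fun _ _ => trivial⟩
    intro u hu v hv
    simp only [hmr] at hu hv ⊢
    rw [hfd _ ⟨by linarith [hu.1], by linarith [hu.2]⟩ _ ⟨by linarith [hv.1], by linarith [hv.2]⟩]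
    congr 1; ring
  have tri1 : |dist (f a) p - a| ≤ dist p q := by
    have := abs_dist_sub_le p q (f a)
    rwa [dist_comm p (f a), dist_comm q (f a), hmq] at this
  have tri1' : dist p q ≤ dist (f a) p + a := by
    have := dist_triangle_left p q (f a)
    rwa [hmq] at this
  have tri2 : |dist (f a) p - b| ≤ dist p r := by
    have := abs_dist_sub_le p r (f a)
    rwa [dist_comm p (f a), dist_comm r (f a), hmr] at this
  have tri2' : dist p r ≤ dist (f a) p + b := by
    have := dist_triangle_left p r (f a)
    rwa [hmr] at this
  have angσ := hX.2 (f a) trivial p trivial q trivial hpm hmq' hpq _ _ hg hσ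
  have angτ := hX.2 (f a) trivial p trivial r trivial hpm hmr' hpr _ _ hg hτ
  simp only [hmq] at angσ
  simp only [hmr] at angτ
  have hcos : ∀ x y z : ℝ, 0 < x → 0 < y → |x - y| ≤ z → z ≤ x + y →
      Real.cos (euclCompAngle x y z) = (x ^ 2 + y ^ 2 - z ^ 2) / (2 * x * y) := by
    intro x y z hx hy h1 h2
    have h0 : 0 ≤ z := (abs_nonneg _).trans h1
    have h1' : (x - y) ^ 2 ≤ z ^ 2 := by rw [← sq_abs (x - y)]; gcongr
    have h2' : z ^ 2 ≤ (x + y) ^ 2 := by gcongr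
    refine Real.cos_arccos ?_ ?_
    · rw [le_div_iff₀ (by positivity)]; nlinarith
    · rw [div_le_iff₀ (by positivity)]; nlinarith
  have hl : 0 < min (min a b) (dist (f a) p) := by positivity
  have hla : min (min a b) (dist (f a) p) ≤ a := (min_le_left _ _).trans (min_le_left _ _)
  have hlb : min (min a b) (dist (f a) p) ≤ b := (min_le_left _ _).trans (min_le_right _ _)
  have hlh : min (min a b) (dist (f a) p) ≤ dist (f a) p := min_le_right _ _
  have key := cos_add_cos_nonpos_of_upperAngleWrt_le (m := f a) (π := g)
    (σ := fun t => f (a - t)) (τ := fun t => f (a + t)) hl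
    (fun t h0 h1 => by
      have := hg.2.2.1.2 0 ⟨le_rfl, hh.le⟩ t ⟨h0, h1.trans hlh⟩
      simpa [hg.1, abs_of_nonneg h0] using this)
    (fun t h0 h1 => by
      have := hfd a ⟨ha.le, by linarith⟩ (a - t) ⟨by linarith, by linarith⟩
      simpa [abs_of_nonneg h0] using this)
    (fun t h0 h1 => by
      have := hfd a ⟨ha.le, by linarith⟩ (a + t) ⟨by linarith, by linarith⟩
      simpa [abs_of_nonneg h0] using this)
    (fun t h0 h1 => by
      have := hfd (a - t) ⟨by linarith, by linarith⟩ (a + t) ⟨by linarith, by linarith⟩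
      rw [this, abs_sub_comm, abs_of_nonneg (by linarith)]; ring)
    (Real.arccos_le_pi _) (Real.arccos_le_pi _)
    (angσ.trans (compAngle_le_euclCompAngle hκ hh ha tri1 tri1'))
    (angτ.trans (compAngle_le_euclCompAngle hκ hh hb tri2 tri2'))
  change Real.cos (euclCompAngle _ _ _) + Real.cos (euclCompAngle _ _ _) ≤ 0 at key
  rw [hcos _ _ _ hh ha tri1 tri1', hcos _ _ _ hh hb tri2 tri2'] at key
  rw [dist_comm p (f a)]
  generalize dist (f a) p = h at *
  have e : (h ^ 2 + a ^ 2 - dist p q ^ 2) / (2 * h * a) +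
      (h ^ 2 + b ^ 2 - dist p r ^ 2) / (2 * h * b) =
      (h ^ 2 - ((1 - s) * dist p q ^ 2 + s * dist p r ^ 2 - s * (1 - s) * D ^ 2)) /
        (2 * h * s * (1 - s) * D) := by
    have : 1 - s ≠ 0 := by linarith
    simp only [a, b]
    field_simp
    ring
  rw [e] at key
  by_contra! hcon
  exact absurd key (not_le.mpr (div_pos (by linarith)
    (mul_pos (mul_pos (by positivity) (by linarith)) hD)))

/-- A CAT(κ) space, `κ ≤ 0`, is contracted to any point along geodesics. -/
lemma IsCATSpace.exists_geodesic_contraction {κ : ℝ} (hκ : κ ≤ 0) (hX : IsCATSpace κ X) (p : X) :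
    ∃ C : C(unitInterval × X, X), (∀ z, C (0, z) = p) ∧ (∀ z, C (1, z) = z) ∧
      ∀ s z, dist p (C (s, z)) = s * dist p z := by
  choose g hg using fun z : X => hX.1 p trivial z trivial
  have hcontr : ∀ (s : unitInterval) z z', dist (g z (s * dist p z)) (g z' (s * dist p z')) ≤
      s * dist z z' := by
    intro s z z'
    have hs0 := s.2.1
    have hs1 := s.2.2
    have hp' : dist p (g z' (s * dist p z')) = s * dist p z' := by
      have := (hg z').2.2.1.2 0 ⟨le_rfl, dist_nonneg⟩ (s * dist p z')
        ⟨by positivity, mul_le_of_le_one_left dist_nonneg hs1⟩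
      rw [(hg z').1, zero_sub, abs_neg, abs_of_nonneg (by positivity)] at this
      exact this
    have h1 := hX.sq_dist_le hκ (hg z) (g z' (s * dist p z')) hs0 hs1
    have h2 := hX.sq_dist_le hκ (hg z') z hs0 hs1
    rw [dist_comm (g z' _) p, hp', dist_comm (g z' _) z] at h1
    rw [dist_comm z p] at h2
    rw [dist_comm]
    refine le_of_sq_le_sq ?_ (by positivity)
    have h3 := mul_le_mul_of_nonneg_left h2 hs0
    nlinarith
  have hspeed : ∀ (s s' : unitInterval) z, dist (g z (s * dist p z)) (g z (s' * dist p z)) =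
      |(s : ℝ) - s'| * dist p z := by
    intro s s' z
    have := (hg z).2.2.1.2 (s * dist p z)
      ⟨mul_nonneg s.2.1 dist_nonneg, mul_le_of_le_one_left dist_nonneg s.2.2⟩ (s' * dist p z)
      ⟨mul_nonneg s'.2.1 dist_nonneg, mul_le_of_le_one_left dist_nonneg s'.2.2⟩
    rw [← sub_mul, abs_mul, abs_of_nonneg (dist_nonneg (x := p))] at this
    exact this
  refine ⟨⟨fun w => g w.2 (w.1 * dist p w.2), ?_⟩, ?_, ?_, ?_⟩
  · rw [continuous_iff_continuousAt]
    rintro ⟨s, z⟩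
    rw [ContinuousAt, tendsto_iff_dist_tendsto_zero]
    have hlim : Tendsto (fun w : unitInterval × X => dist w.2 z + |(w.1 : ℝ) - s| * dist p z)
        (𝓝 (s, z)) (𝓝 0) := Continuous.tendsto' (by fun_prop) _ _ (by simp)
    refine squeeze_zero (fun _ => dist_nonneg) (fun w => ?_) hlim
    refine (dist_triangle _ (g z (w.1 * dist p z)) _).trans ?_
    rw [hspeed]
    gcongr
    exact (hcontr _ _ _).trans (mul_le_of_le_one_left dist_nonneg w.1.2.2)
  · intro z; simpa using (hg z).1
  · intro z; simpa using (hg z).2.1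
  · intro s z
    have := hspeed 0 s z
    simpa [(hg z).1, abs_of_nonneg s.2.1] using this

end Cat2Cx

end

section

open scoped Topology

namespace Cat2Cx

lemma one_add_sq_half_le_cosh (x : ℝ) : 1 + x ^ 2 / 2 ≤ Real.cosh x := by
  have h := (Real.hasSum_cosh x).summable.sum_le_tsum (Finset.range 2)
    (fun n _ => by rw [pow_mul]; positivity)
  rw [(Real.hasSum_cosh x).tsum_eq] at h
  simpa [Finset.sum_range_succ] using h

/-- The excess over `1` of the Lorentz product of two points of the hyperboloid. -/
noncomputable def lorentzExcess (u v : ℝ × ℝ) : ℝ :=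
  Real.sqrt (1 + u.1 ^ 2 + u.2 ^ 2) * Real.sqrt (1 + v.1 ^ 2 + v.2 ^ 2) -
    u.1 * v.1 - u.2 * v.2 - 1

lemma sq_sub_eq_lorentzExcess (u v : ℝ × ℝ) :
    (u.1 - v.1) ^ 2 + (u.2 - v.2) ^ 2 = 2 * lorentzExcess u v +
      (Real.sqrt (1 + u.1 ^ 2 + u.2 ^ 2) - Real.sqrt (1 + v.1 ^ 2 + v.2 ^ 2)) ^ 2 := by
  have hu : Real.sqrt (1 + u.1 ^ 2 + u.2 ^ 2) ^ 2 = 1 + u.1 ^ 2 + u.2 ^ 2 :=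
    Real.sq_sqrt (by positivity)
  have hv : Real.sqrt (1 + v.1 ^ 2 + v.2 ^ 2) ^ 2 = 1 + v.1 ^ 2 + v.2 ^ 2 :=
    Real.sq_sqrt (by positivity)
  unfold lorentzExcess
  nlinarith

lemma lorentzExcess_nonneg (u v : ℝ × ℝ) : 0 ≤ lorentzExcess u v := by
  unfold lorentzExcess
  rw [← Real.sqrt_mul (by positivity)]
  have : 1 + u.1 * v.1 + u.2 * v.2 ≤
      Real.sqrt ((1 + u.1 ^ 2 + u.2 ^ 2) * (1 + v.1 ^ 2 + v.2 ^ 2)) := by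
    refine Real.le_sqrt_of_sq_le ?_
    nlinarith [sq_nonneg (u.1 - v.1), sq_nonneg (u.2 - v.2), sq_nonneg (u.1 * v.2 - u.2 * v.1)]
  linarith

lemma sq_sub_sqrt_le_lorentzExcess (u v : ℝ × ℝ) :
    (Real.sqrt (1 + u.1 ^ 2 + u.2 ^ 2) - Real.sqrt (1 + v.1 ^ 2 + v.2 ^ 2)) ^ 2 ≤
      4 * (1 + v.1 ^ 2 + v.2 ^ 2) * (lorentzExcess u v + lorentzExcess u v ^ 2) := by
  have hQ := lorentzExcess_nonneg u v
  have hu : Real.sqrt (1 + u.1 ^ 2 + u.2 ^ 2) ^ 2 = 1 + u.1 ^ 2 + u.2 ^ 2 :=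
    Real.sq_sqrt (by positivity)
  have hv : Real.sqrt (1 + v.1 ^ 2 + v.2 ^ 2) ^ 2 = 1 + v.1 ^ 2 + v.2 ^ 2 :=
    Real.sq_sqrt (by positivity)
  have hq : Real.sqrt (1 + u.1 ^ 2 + u.2 ^ 2) * Real.sqrt (1 + v.1 ^ 2 + v.2 ^ 2) -
    1 - lorentzExcess u v = u.1 * v.1 + u.2 * v.2 := by unfold lorentzExcess; ring
  generalize Real.sqrt (1 + u.1 ^ 2 + u.2 ^ 2) = U at *
  generalize Real.sqrt (1 + v.1 ^ 2 + v.2 ^ 2) = V at *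
  generalize lorentzExcess u v = Q at *
  have h1 : (U * V - 1 - Q) ^ 2 ≤ (U ^ 2 - 1) * (V ^ 2 - 1) := by
    rw [hq, hu, hv]
    nlinarith [sq_nonneg (u.1 * v.2 - u.2 * v.1)]
  have h2 : (U - V) ^ 2 ≤ 2 * Q * V * (U - V) + 2 * Q * V ^ 2 := by nlinarith
  rw [← hv]
  nlinarith [sq_nonneg (U - V - 2 * Q * V)]

lemma mDist_of_neg {κ : ℝ} (hκ : κ < 0) (u v : ℝ × ℝ) :
    mDist κ u v = 1 / Real.sqrt (-κ) * Real.arcosh (1 + lorentzExcess u v) := by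
  unfold mDist
  rw [if_neg hκ.ne]
  unfold arcosh Real.arcosh lorentzExcess
  ring_nf

/-- The distance of the model plane is dominated by that of the coordinates. -/
lemma exists_mDist_le {κ : ℝ} (hκ : κ ≤ 0) :
    ∃ K : NNReal, ∀ u v : ℝ × ℝ, mDist κ u v ≤ K * dist u v := by
  have hE : ∀ u v : ℝ × ℝ, (u.1 - v.1) ^ 2 + (u.2 - v.2) ^ 2 ≤ (2 * dist u v) ^ 2 := by
    intro u v
    have h1 : |u.1 - v.1| ≤ dist u v := by
      rw [← Real.dist_eq, Prod.dist_eq]; exact le_max_left _ _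
    have h2 : |u.2 - v.2| ≤ dist u v := by
      rw [← Real.dist_eq, Prod.dist_eq]; exact le_max_right _ _
    have := sq_le_sq' (by linarith [abs_nonneg (u.1 - v.1)]) h1
    have := sq_le_sq' (by linarith [abs_nonneg (u.2 - v.2)]) h2
    rw [sq_abs] at *
    nlinarith [sq_nonneg (dist u v)]
  rcases hκ.eq_or_lt with rfl | hκ
  · refine ⟨2, fun u v => ?_⟩
    simp only [mDist, if_true, NNReal.coe_ofNat]
    exact Real.sqrt_le_iff.mpr ⟨by positivity, hE u v⟩
  · refine ⟨Real.toNNReal (1 / Real.sqrt (-κ) * 2), fun u v => ?_⟩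
    rw [mDist_of_neg hκ, Real.coe_toNNReal _ (by positivity), mul_assoc]
    gcongr
    have hQ := lorentzExcess_nonneg u v
    rw [← Real.arcosh_cosh (x := 2 * dist u v) (by positivity)]
    refine (Real.arcosh_le_arcosh (by linarith) (Real.cosh_pos _)).mpr ?_
    refine le_trans ?_ (one_add_sq_half_le_cosh _)
    have := sq_sub_eq_lorentzExcess u v
    nlinarith [hE u v, sq_nonneg (Real.sqrt (1 + u.1 ^ 2 + u.2 ^ 2) -
      Real.sqrt (1 + v.1 ^ 2 + v.2 ^ 2))]

/-- Convergence for the distance of the model plane implies convergence of the coordinates. -/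
lemma tendsto_of_mDist_tendsto_zero {κ : ℝ} (hκ : κ ≤ 0) {α : Type*} {l : Filter α}
    {u : α → ℝ × ℝ} {v : ℝ × ℝ} (h : Tendsto (fun a => mDist κ (u a) v) l (𝓝 0)) :
    Tendsto u l (𝓝 v) := by
  suffices hs : Tendsto (fun a => ((u a).1 - v.1) ^ 2 + ((u a).2 - v.2) ^ 2) l (𝓝 0) by
    rw [tendsto_iff_dist_tendsto_zero]
    have := hs.sqrt
    rw [Real.sqrt_zero] at this
    refine squeeze_zero (fun _ => dist_nonneg) (fun a => ?_) this
    rw [Prod.dist_eq, Real.dist_eq, Real.dist_eq]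
    refine max_le (Real.abs_le_sqrt ?_) (Real.abs_le_sqrt ?_)
    · nlinarith [sq_nonneg ((u a).2 - v.2)]
    · nlinarith [sq_nonneg ((u a).1 - v.1)]
  rcases hκ.eq_or_lt with rfl | hκ
  · have := h.pow 2
    simp only [mDist, if_true] at this
    refine (this.congr fun a => Real.sq_sqrt (by positivity)).trans (by simp)
  · have hk : 0 < Real.sqrt (-κ) := Real.sqrt_pos.mpr (by linarith)
    have hQ : Tendsto (fun a => lorentzExcess (u a) v) l (𝓝 0) := by
      have h1 := ((Real.continuous_cosh.tendsto _).comp (h.const_mul (Real.sqrt (-κ)))).sub_const 1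
      simp only [mul_zero, Real.cosh_zero, sub_self] at h1
      refine h1.congr fun a => ?_
      have := lorentzExcess_nonneg (u a) v
      simp only [Function.comp, mDist_of_neg hκ]
      rw [← mul_assoc, mul_one_div_cancel hk.ne', one_mul, Real.cosh_arcosh (by linarith)]
      ring
    have hb : Tendsto (fun a => 2 * lorentzExcess (u a) v + 4 * (1 + v.1 ^ 2 + v.2 ^ 2) *
        (lorentzExcess (u a) v + lorentzExcess (u a) v ^ 2)) l (𝓝 0) := by
      have := (hQ.const_mul 2).add ((hQ.add (hQ.pow 2)).const_mul (4 * (1 + v.1 ^ 2 + v.2 ^ 2)))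
      simpa using this
    refine squeeze_zero (fun _ => by positivity) (fun a => ?_) hb
    rw [sq_sub_eq_lorentzExcess]
    gcongr
    exact sq_sub_sqrt_le_lorentzExcess _ _

end Cat2Cx

end

section

open scoped unitInterval Topology

namespace Cat2Cx

variable {X : Type*} [MetricSpace X]

lemma continuousOn_of_mDist_eq {κ : ℝ} (hκ : κ ≤ 0) {F : Set X} {f : X → ℝ × ℝ}
    (hf : ∀ x ∈ F, ∀ y ∈ F, mDist κ (f x) (f y) = dist x y) : ContinuousOn f F := fun z hz => by
  refine tendsto_of_mDist_tendsto_zero hκ ?_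
  have : Tendsto (fun y => dist y z) (𝓝[F] z) (𝓝 0) :=
    (Continuous.tendsto' (by fun_prop) z 0 (by simp)).mono_left nhdsWithin_le_nhds
  exact this.congr' (by filter_upwards [self_mem_nhdsWithin] with y hy using (hf y hy z hz).symm)

/-- A planar coordinate near a point of a face extends to a continuous function on a CAT(κ) space
without further zeros. -/
lemma IsCATSpace.exists_coordinate {κ : ℝ} (hκ : κ ≤ 0) (hX : IsCATSpace κ X) {F : Set X}
    (hF : IsOpen F) {f : X → ℝ × ℝ} (hinj : InjOn f F)
    (hf : ∀ x ∈ F, ∀ y ∈ F, mDist κ (f x) (f y) = dist x y) {d : X} (hd : d ∈ F) :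
    ∃ R : C(X, ℂ), (∀ z, R z = 0 ↔ z = d) ∧
      ∀ᶠ z in 𝓝 d, R z = Complex.equivRealProdCLM.symm (f z - f d) := by
  have hfc := continuousOn_of_mDist_eq hκ hf
  obtain ⟨r, hr, hrF⟩ := nhds_basis_closedBall.mem_iff.mp (hF.mem_nhds hd)
  obtain ⟨C, -, hC1, hCd⟩ := hX.exists_geodesic_contraction hκ d
  have hpos : ∀ z, 0 < max r (dist d z) := fun z => lt_max_of_lt_left hr
  let s : X → I := fun z => ⟨r / max r (dist d z), by
    have := hpos z
    exact ⟨by positivity, (div_le_one this).mpr (le_max_left _ _)⟩⟩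
  have hs : Continuous s := Continuous.subtype_mk
    (continuous_const.div (by fun_prop) fun z => (hpos z).ne') _
  let ρ : X → X := fun z => C (s z, z)
  have hρ : Continuous ρ := C.continuous.comp (hs.prodMk continuous_id)
  have hρd : ∀ z, dist d (ρ z) = r / max r (dist d z) * dist d z := fun z => hCd _ _
  have hρF : ∀ z, ρ z ∈ F := fun z => hrF <| by
    have := hpos z
    rw [mem_closedBall', hρd, div_mul_eq_mul_div, div_le_iff₀ this]
    gcongr
    exact le_max_right _ _
  have hρ0 : ∀ z, ρ z = d ↔ z = d := fun z => by
    have := hpos z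
    rw [eq_comm, ← dist_eq_zero, hρd, mul_eq_zero, or_iff_right (by positivity), dist_eq_zero,
      eq_comm]
  refine ⟨⟨fun z => Complex.equivRealProdCLM.symm (f (ρ z) - f d), ?_⟩, fun z => ?_, ?_⟩
  · exact Complex.equivRealProdCLM.symm.continuous.comp
      ((hfc.comp_continuous hρ hρF).sub continuous_const)
  · rw [ContinuousMap.coe_mk, map_eq_zero_iff _ Complex.equivRealProdCLM.symm.injective,
      sub_eq_zero, hinj.eq_iff (hρF z) hd, hρ0]
  · filter_upwards [ball_mem_nhds d hr] with z hz
    have hs1 : s z = 1 := Subtype.ext <| by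
      change r / max r (dist d z) = 1
      rw [max_eq_left (mem_ball'.mp hz).le, div_self hr.ne']
    simp only [ContinuousMap.coe_mk, ρ, hs1, hC1]

lemma div_mem_slitPlane {w v : ℂ} (h : ‖w - v‖ < ‖v‖) : w / v ∈ Complex.slitPlane := by
  have hv : 0 < ‖v‖ := (norm_nonneg _).trans_lt h
  have hv' : v ≠ 0 := norm_pos_iff.mp hv
  have : w / v = 1 + (w - v) / v := by field_simp; ring
  rw [this]
  refine Complex.mem_slitPlane_of_norm_lt_one ?_
  rwa [norm_div, div_lt_one hv]

lemma RemovableZero.of_norm_sub_lt {p : I → X} {H : X → ℂ} (hH : Continuous H) {d : X}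
    {R : C(X, ℂ)} (hR : ∀ z, R z = 0 ↔ z = d) (hlog : HasClosedLog (fun t => R (p t))) {a : ℂ}
    (ha : a ≠ 0) (hHR : ∀ᶠ z in 𝓝[≠] d, ‖H z - a * R z‖ < ‖a * R z‖) : RemovableZero p H d := by
  refine ⟨R, hR, hlog, fun z => Complex.log (H z / (a * R z)) + Complex.log a, _,
    eventually_nhdsWithin_iff.mp hHR, ?_, ?_⟩
  · refine ContinuousOn.add (ContinuousOn.clog ?_ ?_) continuousOn_const
    · refine hH.continuousOn.div (by fun_prop) ?_
      rintro z ⟨-, hzd⟩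
      exact mul_ne_zero ha fun h => hzd ((hR z).mp h)
    · rintro z ⟨hz, hzd⟩
      exact div_mem_slitPlane (hz hzd)
  · rintro z ⟨hz, hzd⟩
    have hRz : R z ≠ 0 := fun h => hzd ((hR z).mp h)
    rw [Complex.exp_add, Complex.exp_log ha,
      Complex.exp_log (Complex.slitPlane_ne_zero (div_mem_slitPlane (hz hzd)))]
    field_simp

/-- A continuous function that agrees to first order with an injective real-linear function of a
coordinate `R` has a removable zero. -/
lemma RemovableZero.of_isLittleO {p : I → X} {H : X → ℂ} (hH : Continuous H) {d : X}
    {R : C(X, ℂ)} (hR : ∀ z, R z = 0 ↔ z = d) (hlog : HasClosedLog (fun t => R (p t)))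
    {A : ℂ →L[ℝ] ℂ} (hA : Function.Injective A)
    (hHR : (fun z => H z - A (R z)) =o[𝓝 d] fun z => R z) : RemovableZero p H d := by
  obtain ⟨a, b, hab⟩ : ∃ a b : ℂ, ∀ v, A v = a * v + b * starRingEnd ℂ v := by
    refine ⟨(A 1 - Complex.I * A Complex.I) / 2, (A 1 + Complex.I * A Complex.I) / 2, fun v => ?_⟩
    have hv : v = v.re • (1 : ℂ) + v.im • Complex.I := by simp
    conv_lhs => rw [hv, map_add, map_smul, map_smul]
    apply Complex.ext <;> simp <;> ring
  have hne : ‖a‖ ≠ ‖b‖ := by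
    intro h
    have hn : a * starRingEnd ℂ a = b * starRingEnd ℂ b := by
      rw [Complex.mul_conj', Complex.mul_conj', h]
    have h1 : starRingEnd ℂ a - b = 0 := hA <| by
      rw [map_zero, hab, map_sub, Complex.conj_conj]
      linear_combination hn
    have h2 : Complex.I * (starRingEnd ℂ a + b) = 0 := hA <| by
      rw [map_zero, hab, map_mul, map_add, Complex.conj_conj, Complex.conj_I]
      linear_combination Complex.I * hn
    have h3 : starRingEnd ℂ a + b = 0 := (mul_eq_zero.mp h2).resolve_left Complex.I_ne_zero
    have hb : b = 0 := by linear_combination (h3 - h1) / 2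
    have ha : a = 0 := by rw [← norm_eq_zero, h, hb, norm_zero]
    exact one_ne_zero (hA (a₁ := (1 : ℂ)) (a₂ := 0) (by simp [hab, ha, hb]))
  have hsmall : ∀ c > 0, ∀ᶠ z in 𝓝[≠] d, R z ≠ 0 ∧ ‖H z - A (R z)‖ ≤ c * ‖R z‖ := by
    intro c hc
    filter_upwards [nhdsWithin_le_nhds (hHR.def hc), self_mem_nhdsWithin] with z hz hzd
    exact ⟨fun h => hzd ((hR z).mp h), hz⟩
  rcases hne.lt_or_gt with hlt | hlt
  · have hb : b ≠ 0 := norm_pos_iff.mp ((norm_nonneg _).trans_lt hlt)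
    let R' : C(X, ℂ) := ⟨fun z => starRingEnd ℂ (R z), by fun_prop⟩
    refine RemovableZero.of_norm_sub_lt (R := R') hH (fun z => ?_) hlog.conj hb ?_
    · simp [R', hR]
    · filter_upwards [hsmall ((‖b‖ - ‖a‖) / 2) (by linarith)] with z hz
      have hRz : 0 < ‖R z‖ := norm_pos_iff.mpr hz.1
      have e : H z - b * R' z = (H z - A (R z)) + a * R z := by
        rw [hab]
        simp only [R', ContinuousMap.coe_mk]
        ring
      rw [e]
      refine (norm_add_le _ _).trans_lt ?_
      rw [norm_mul, norm_mul, show ‖R' z‖ = ‖R z‖ from RCLike.norm_conj _]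
      nlinarith [hz.2]
  · have ha : a ≠ 0 := norm_pos_iff.mp ((norm_nonneg _).trans_lt hlt)
    refine RemovableZero.of_norm_sub_lt hH hR hlog ha ?_
    filter_upwards [hsmall ((‖a‖ - ‖b‖) / 2) (by linarith)] with z hz
    have hRz : 0 < ‖R z‖ := norm_pos_iff.mpr hz.1
    have e : H z - a * R z = (H z - A (R z)) + b * starRingEnd ℂ (R z) := by rw [hab]; ring
    rw [e]
    refine (norm_add_le _ _).trans_lt ?_
    rw [norm_mul, norm_mul, RCLike.norm_conj]
    nlinarith [hz.2]

/-- A zero of `H` at a point of a face outside the interior of `γ` is removable as soon as `H` has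
an invertible derivative there. -/
lemma SCC.removableZero_of_notMem_interiorSet {κ : ℝ} (hκ : κ ≤ 0) (hX : IsCATSpace κ X)
    (γ : SCC X) {F : Set X} (hF : IsOpen F) {f : X → ℝ × ℝ} (hinj : InjOn f F)
    (hf : ∀ x ∈ F, ∀ y ∈ F, mDist κ (f x) (f y) = dist x y) {d : X} (hd : d ∈ F)
    (hdγ : d ∉ γ.img) (hdint : d ∉ γ.interiorSet) {H : X → ℂ} (hH : Continuous H) (hHd : H d = 0)
    {G : ℝ × ℝ → ℝ × ℝ} (hGH : ∀ z ∈ F, H z = Complex.equivRealProdCLM.symm (G (f z)))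
    (hG : DifferentiableAt ℝ G (f d)) (hdet : (fderiv ℝ G (f d)).det ≠ 0) :
    RemovableZero (fun t : I => γ.toFun t) H d := by
  obtain ⟨R, hR0, hR⟩ := hX.exists_coordinate hκ hF hinj hf hd
  have hn : γ.NullhomologousIn {d}ᶜ := by
    by_contra h
    exact hdint ⟨hdγ, h⟩
  have hlog := γ.hasClosedLog_of_nullhomologousIn d hdγ hn R fun z hz h => hz ((hR0 z).mp h)
  let e := Complex.equivRealProdCLM
  have hLinj : Function.Injective (fderiv ℝ G (f d)) := by
    have : IsUnit (fderiv ℝ G (f d) : ℝ × ℝ →ₗ[ℝ] ℝ × ℝ) :=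
      LinearMap.isUnit_iff_isUnit_det _ |>.mpr (isUnit_iff_ne_zero.mpr hdet)
    exact ((Module.End.isUnit_iff _).mp this).1
  refine RemovableZero.of_isLittleO hH hR0 hlog
    (A := (e.symm : ℝ × ℝ →L[ℝ] ℂ) ∘L fderiv ℝ G (f d) ∘L (e : ℂ →L[ℝ] ℝ × ℝ))
    (e.symm.injective.comp (hLinj.comp e.injective)) ?_
  have hfc : Tendsto f (𝓝 d) (𝓝 (f d)) :=
    (continuousOn_of_mDist_eq hκ hf).continuousAt (hF.mem_nhds hd)
  have ho := hG.hasFDerivAt.isLittleO.comp_tendsto hfc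
  have hGd : G (f d) = 0 := by
    have := hGH d hd
    rw [hHd] at this
    exact e.symm.injective (by rw [← this, map_zero])
  have h1 : (fun z => H z - ((e.symm : ℝ × ℝ →L[ℝ] ℂ) ∘L fderiv ℝ G (f d) ∘L
      (e : ℂ →L[ℝ] ℝ × ℝ)) (R z)) =ᶠ[𝓝 d]
      fun z => e.symm (G (f z) - G (f d) - fderiv ℝ G (f d) (f z - f d)) := by
    filter_upwards [hR, hF.mem_nhds hd] with z hz hzF
    have hez : e (R z) = f z - f d := by rw [hz]; exact e.apply_symm_apply _
    simp only [ContinuousLinearMap.comp_apply, ContinuousLinearEquiv.coe_coe, hez]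
    rw [hGH z hzF, hGd, sub_zero, map_sub e.symm]
  have h2 : (fun z => f z - f d) =ᶠ[𝓝 d] fun z => e (R z) := by
    filter_upwards [hR] with z hz
    rw [hz]; exact (e.apply_symm_apply _).symm
  refine h1.trans_isLittleO ?_
  refine (e.symm.isBigO_comp _ _).trans_isLittleO (ho.trans_isBigO ?_)
  exact h2.trans_isBigO (e.isBigO_comp _ _)

end Cat2Cx

end

section

open scoped unitInterval Topology

namespace Cat2Cx

section
open MeasureTheory

/-- A Lipschitz map of the plane has almost no critical values, in the strong sense that takes
points of nondifferentiability into account. -/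
lemma volume_image_critical_eq_zero {K : NNReal} {G : ℝ × ℝ → ℝ × ℝ} (hG : LipschitzWith K G) :
    volume (G '' {u | DifferentiableAt ℝ G u → (fderiv ℝ G u).det = 0}) = 0 := by
  have h1 : volume (G '' {u | ¬ DifferentiableAt ℝ G u}) = 0 := by
    have h := hG.hausdorffMeasure_image_le (d := 2) zero_le_two {u | ¬ DifferentiableAt ℝ G u}
    have h0 : volume {u | ¬ DifferentiableAt ℝ G u} = 0 :=
      ae_iff.mp (hG.ae_differentiableAt (μ := volume))
    rw [hausdorffMeasure_prod_real, h0, mul_zero] at h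
    exact nonpos_iff_eq_zero.mp h
  have h2 : volume (G '' {u | DifferentiableAt ℝ G u ∧ (fderiv ℝ G u).det = 0}) = 0 :=
    addHaar_image_eq_zero_of_det_fderivWithin_eq_zero volume (f' := fderiv ℝ G)
      (fun u hu => hu.1.hasFDerivAt.hasFDerivWithinAt) fun u hu => hu.2
  refine measure_mono_null ?_ (measure_union_null h1 h2)
  rw [← image_union]
  refine image_mono fun u hu => ?_
  by_cases h : DifferentiableAt ℝ G u
  · exact Or.inr ⟨h, hu h⟩
  · exact Or.inl h

lemma volume_image_Ioo_eq_zero {K : NNReal} {g : ℝ → ℝ × ℝ} {a b : ℝ}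
    (hg : LipschitzOnWith K g (Ioo a b)) : volume (g '' Ioo a b) = 0 := by
  have h := hg.hausdorffMeasure_image_le (d := 2) zero_le_two
  have h0 : Measure.hausdorffMeasure 2 (Ioo a b) = 0 := by
    refine (Measure.hausdorffMeasure_zero_or_top one_lt_two _).resolve_right ?_
    rw [hausdorffMeasure_real]
    exact measure_Ioo_lt_top.ne
  rw [hausdorffMeasure_prod_real, h0, mul_zero] at h
  exact nonpos_iff_eq_zero.mp h

variable {X : Type*} [MetricSpace X]

/-- A Lipschitz map to the plane factors, on a face, through a Lipschitz map of the plane. -/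
lemma exists_lipschitzWith_comp_eq {κ : ℝ} (hκ : κ ≤ 0) {F : Set X} {f : X → ℝ × ℝ}
    (hinj : InjOn f F) (hf : ∀ x ∈ F, ∀ y ∈ F, mDist κ (f x) (f y) = dist x y) {K : NNReal}
    {H : X → ℝ × ℝ} (hH : LipschitzWith K H) :
    ∃ (K' : NNReal) (G : ℝ × ℝ → ℝ × ℝ), LipschitzWith K' G ∧ ∀ z ∈ F, G (f z) = H z := by
  rcases F.eq_empty_or_nonempty with rfl | ⟨z₀, -⟩
  · exact ⟨0, 0, LipschitzWith.const 0, by simp⟩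
  have : Nonempty X := ⟨z₀⟩
  obtain ⟨M, hM⟩ := exists_mDist_le hκ
  have hg : LipschitzOnWith (K * M) (fun u => H (Function.invFunOn f F u)) (f '' F) := by
    refine LipschitzOnWith.of_dist_le_mul ?_
    rintro _ ⟨x, hx, rfl⟩ _ ⟨y, hy, rfl⟩
    rw [hinj.leftInvOn_invFunOn hx, hinj.leftInvOn_invFunOn hy]
    refine (hH.dist_le_mul x y).trans ?_
    rw [← hf x hx y hy, NNReal.coe_mul, mul_assoc]
    gcongr
    exact hM _ _
  obtain ⟨g₁, hg₁, h₁⟩ := ((LipschitzWith.prod_fst.lipschitzOnWith (s := univ)).comp hg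
    (mapsTo_univ _ _)).extend_real
  obtain ⟨g₂, hg₂, h₂⟩ := ((LipschitzWith.prod_snd.lipschitzOnWith (s := univ)).comp hg
    (mapsTo_univ _ _)).extend_real
  refine ⟨_, fun u => (g₁ u, g₂ u), hg₁.prodMk hg₂, fun z hz => ?_⟩
  simp only [← h₁ (mem_image_of_mem f hz), ← h₂ (mem_image_of_mem f hz), Function.comp,
    hinj.leftInvOn_invFunOn hz]

/-- Arbitrarily small values `c` of a Lipschitz map to the plane are regular on a ball that meets
finitely many cells. -/
lemma PolyComplex2.exists_regular_value {κ : ℝ} (hκ : κ ≤ 0) (PC : PolyComplex2 κ X) {K : NNReal}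
    {H : X → ℝ × ℝ} (hH : LipschitzWith K H) {x : X} {ε : ℝ}
    (hfin : {c | (c ∈ PC.faces ∨ c ∈ PC.edges) ∧ (c ∩ ball x ε).Nonempty}.Finite)
    (hfin' : (PC.vertices ∩ ball x ε).Finite) {δ : ℝ} (hδ : 0 < δ) :
    ∃ c : ℝ × ℝ, ‖c‖ < δ ∧ ∀ d ∈ ball x ε, H d = c → ∃ F ∈ PC.faces, d ∈ F ∧
      ∃ (f : X → ℝ × ℝ) (G : ℝ × ℝ → ℝ × ℝ), InjOn f F ∧
        (∀ x ∈ F, ∀ y ∈ F, mDist κ (f x) (f y) = dist x y) ∧ (∀ z ∈ F, G (f z) = H z) ∧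
        DifferentiableAt ℝ G (f d) ∧ (fderiv ℝ G (f d)).det ≠ 0 := by
  set B : Set X := {d | ¬ ∃ F ∈ PC.faces, d ∈ F ∧
      ∃ (f : X → ℝ × ℝ) (G : ℝ × ℝ → ℝ × ℝ), InjOn f F ∧
        (∀ x ∈ F, ∀ y ∈ F, mDist κ (f x) (f y) = dist x y) ∧ (∀ z ∈ F, G (f z) = H z) ∧
        DifferentiableAt ℝ G (f d) ∧ (fderiv ℝ G (f d)).det ≠ 0} with hB
  have hface : ∀ F ∈ PC.faces, volume (H '' (F ∩ B)) = 0 := by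
    intro F hF
    obtain ⟨f, P, -, hinj, -, -, hf⟩ := PC.face_chart F hF
    replace hinj := hinj.mono subset_closure
    have hf' : ∀ x ∈ F, ∀ y ∈ F, mDist κ (f x) (f y) = dist x y :=
      fun x hx y hy => hf x (subset_closure hx) y (subset_closure hy)
    obtain ⟨K', G, hG, hGH⟩ := exists_lipschitzWith_comp_eq hκ hinj hf' hH
    refine measure_mono_null ?_ (volume_image_critical_eq_zero hG)
    rintro _ ⟨d, ⟨hdF, hdB⟩, rfl⟩
    refine ⟨f d, fun hdiff => ?_, hGH d hdF⟩
    by_contra hdet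
    exact hdB ⟨F, hF, hdF, f, G, hinj, hf', hGH, hdiff, hdet⟩
  have hedge : ∀ e ∈ PC.edges, volume (H '' e) = 0 := by
    intro e he
    obtain ⟨f, L, -, hf, rfl⟩ := PC.edge_geodesic e he
    rw [← image_comp]
    have hfl : LipschitzOnWith 1 f (Ioo 0 L) := LipschitzOnWith.of_dist_le_mul fun s hs t ht => by
      rw [NNReal.coe_one, one_mul, Real.dist_eq]
      exact (hf.2 s (Ioo_subset_Icc_self hs) t (Ioo_subset_Icc_self ht)).le
    exact volume_image_Ioo_eq_zero
      ((hH.lipschitzOnWith (s := univ)).comp hfl (mapsTo_univ _ _))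
  have hnull : volume (H '' (B ∩ ball x ε)) = 0 := by
    have hcells : volume (⋃ c ∈ {c | (c ∈ PC.faces ∨ c ∈ PC.edges) ∧ (c ∩ ball x ε).Nonempty},
        H '' (c ∩ B)) = 0 := by
      refine (measure_biUnion_null_iff hfin.countable).mpr ?_
      rintro c ⟨hc | hc, -⟩
      · exact hface c hc
      · exact measure_mono_null (image_mono inter_subset_left) (hedge c hc)
    refine measure_mono_null ?_
      (measure_union_null hcells ((hfin'.image H).measure_zero volume))
    rintro _ ⟨d, ⟨hdB, hd⟩, rfl⟩
    have hcov : d ∈ ⋃₀ PC.faces ∪ ⋃₀ PC.edges ∪ PC.vertices := PC.cover ▸ mem_univ d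
    rcases hcov with (⟨c, hc, hdc⟩ | ⟨c, hc, hdc⟩) | hv
    · exact Or.inl (mem_biUnion (x := c) ⟨Or.inl hc, d, hdc, hd⟩ ⟨d, ⟨hdc, hdB⟩, rfl⟩)
    · exact Or.inl (mem_biUnion (x := c) ⟨Or.inr hc, d, hdc, hd⟩ ⟨d, ⟨hdc, hdB⟩, rfl⟩)
    · exact Or.inr ⟨d, ⟨hv, hd⟩, rfl⟩
  obtain ⟨c, hc, hcB⟩ : ∃ c ∈ ball (0 : ℝ × ℝ) δ, c ∉ H '' (B ∩ ball x ε) := by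
    by_contra! h
    exact (measure_ball_pos volume (0 : ℝ × ℝ) hδ).ne' (measure_mono_null h hnull)
  refine ⟨c, by simpa using hc, fun d hd hdc => ?_⟩
  by_contra hd'
  exact hcB ⟨d, ⟨hd', hd⟩, hdc⟩

end

end Cat2Cx

end

section

open scoped unitInterval Topology

namespace Cat2Cx

variable {X : Type*} [MetricSpace X]

/-- A bounded uniformly continuous function on a subset is uniformly approximated by Lipschitz
functions on the whole space. -/
lemma exists_lipschitzWith_abs_sub_le {S : Set X} {f : X → ℝ} {M : ℝ} (hM : ∀ z ∈ S, |f z| ≤ M)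
    (hf : UniformContinuousOn f S) {η : ℝ} (hη : 0 < η) :
    ∃ (C : NNReal) (g : X → ℝ), LipschitzWith C g ∧ ∀ z ∈ S, |g z - f z| ≤ η := by
  rcases S.eq_empty_or_nonempty with rfl | ⟨z₀, hz₀⟩
  · exact ⟨0, 0, LipschitzWith.const 0, by simp⟩
  have : Nonempty S := ⟨⟨z₀, hz₀⟩⟩
  have hM0 : 0 ≤ M := (abs_nonneg _).trans (hM z₀ hz₀)
  obtain ⟨δ, hδ, hfδ⟩ := Metric.uniformContinuousOn_iff_le.mp hf η hη
  obtain ⟨C, hC⟩ : ∃ C : NNReal, (C : ℝ) = 2 * M / δ := ⟨⟨2 * M / δ, by positivity⟩, rfl⟩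
  have hbdd : ∀ z, BddBelow (range fun y : S => f y + C * dist (y : X) z) := by
    refine fun z => ⟨-M, ?_⟩
    rintro _ ⟨y, rfl⟩
    have := neg_le_of_abs_le (hM y y.2)
    have : 0 ≤ C * dist (y : X) z := by positivity
    simp only
    linarith
  refine ⟨C, fun z => ⨅ y : S, (f y + C * dist (y : X) z), ?_, fun z hz => ?_⟩
  · refine LipschitzWith.of_le_add_mul C fun z z' => ?_
    rw [← sub_le_iff_le_add]
    refine le_ciInf fun y => ?_
    rw [sub_le_iff_le_add]
    refine (ciInf_le (hbdd z) y).trans ?_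
    have := mul_le_mul_of_nonneg_left (dist_triangle_right (y : X) z z') C.2
    change (C : ℝ) * _ ≤ (C : ℝ) * _ at this
    linarith
  · have h1 : (⨅ y : S, (f y + C * dist (y : X) z)) ≤ f z :=
      (ciInf_le (hbdd z) ⟨z, hz⟩).trans (by simp)
    have h2 : f z - η ≤ ⨅ y : S, (f y + C * dist (y : X) z) := by
      refine le_ciInf fun y => ?_
      rcases le_total (dist (y : X) z) δ with h | h
      · have := le_of_abs_le (hfδ y y.2 z hz h)
        have h' := abs_le.mp (hfδ y y.2 z hz h)
        have : 0 ≤ C * dist (y : X) z := by positivity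
        linarith [h'.1]
      · have h3 : 2 * M ≤ C * dist (y : X) z := by
          rw [hC, div_mul_eq_mul_div, le_div_iff₀ hδ]
          gcongr
        linarith [neg_le_of_abs_le (hM y y.2), le_of_abs_le (hM z hz)]
    rw [abs_le]
    constructor <;> linarith

lemma SCC.eq_or_eq_endpoints (γ : SCC X) {s t : I} (h : γ.toFun s = γ.toFun t) :
    s = t ∨ ((s = 0 ∨ s = 1) ∧ (t = 0 ∨ t = 1)) := by
  rcases eq_or_ne s 1 with rfl | hs <;> rcases eq_or_ne t 1 with rfl | ht
  · simp
  · right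
    have ht' : (t : ℝ) ∈ Ico (0 : ℝ) 1 := ⟨t.2.1, lt_of_le_of_ne t.2.2 fun h => ht (Subtype.ext h)⟩
    have := γ.inj (left_mem_Ico.mpr one_pos) ht' (γ.loop.trans h)
    exact ⟨Or.inr rfl, Or.inl (Subtype.ext this.symm)⟩
  · right
    have hs' : (s : ℝ) ∈ Ico (0 : ℝ) 1 := ⟨s.2.1, lt_of_le_of_ne s.2.2 fun h => hs (Subtype.ext h)⟩
    have := γ.inj hs' (left_mem_Ico.mpr one_pos) (h.trans γ.loop.symm)
    exact ⟨Or.inl (Subtype.ext this), Or.inr rfl⟩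
  · left
    have ht' : (t : ℝ) ∈ Ico (0 : ℝ) 1 := ⟨t.2.1, lt_of_le_of_ne t.2.2 fun h => ht (Subtype.ext h)⟩
    have hs' : (s : ℝ) ∈ Ico (0 : ℝ) 1 := ⟨s.2.1, lt_of_le_of_ne s.2.2 fun h => hs (Subtype.ext h)⟩
    exact Subtype.ext (γ.inj hs' ht' h)

/-- A continuous function of the parameter that vanishes at both ends descends to a
simple closed curve. -/
lemma SCC.exists_continuousOn_comp_eq (γ : SCC X) (E : C(I, ℂ)) (h0 : E 0 = 0) (h1 : E 1 = 0) :
    ∃ f : X → ℂ, ContinuousOn f γ.img ∧ (∀ t : I, f (γ.toFun t) = E t) ∧ ∀ z ∉ γ.img, f z = 0 := by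
  classical
  have hmem : ∀ t : I, γ.toFun t ∈ γ.img := fun t => mem_image_of_mem _ t.2
  have hex : ∀ z ∈ γ.img, ∃ t : I, γ.toFun t = z := by
    rintro _ ⟨t, ht, rfl⟩
    exact ⟨⟨t, ht⟩, rfl⟩
  choose! τ hτ using hex
  have hE : ∀ t : I, E (τ (γ.toFun t)) = E t := by
    intro t
    rcases γ.eq_or_eq_endpoints (hτ _ (hmem t)) with h | ⟨hs | hs, ht | ht⟩
    · rw [h]
    all_goals rw [hs, ht]
    · rw [h0, h1]
    · rw [h0, h1]
  refine ⟨fun z => if z ∈ γ.img then E (τ z) else 0, ?_, fun t => ?_, fun z hz => if_neg hz⟩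
  · rw [continuousOn_iff_continuous_domRestrict]
    let q : I → γ.img := fun t => ⟨γ.toFun t, hmem t⟩
    have hqc : Continuous q :=
      (γ.contOn.comp_continuous continuous_subtype_val fun t => t.2).subtype_mk _
    have hqs : Function.Surjective q := fun z => ⟨τ z, Subtype.ext (hτ z z.2)⟩
    rw [(Topology.IsQuotientMap.of_surjective_continuous hqs hqc).continuous_iff]
    refine E.continuous.congr fun t => ?_
    simp only [Function.comp, domRestrict_apply, q, if_pos (hmem t), hE]
  · simp only [if_pos (hmem t), hE]

lemma SCC.isCompact_img (γ : SCC X) : IsCompact γ.img :=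
  isCompact_Icc.image_of_continuousOn γ.contOn

/-- A Lipschitz map to the plane which is close to `1` outside a small ball around a point of a
simple closed curve, while it winds once around `0` along the curve. -/
lemma SCC.exists_winding_lipschitzWith (γ : SCC X) {t₀ : ℝ} (ht₀ : t₀ ∈ Ioo (0 : ℝ) 1) {ε : ℝ}
    (hε : 0 < ε) :
    ∃ (K : NNReal) (H : X → ℝ × ℝ) (θ : C(I, ℝ)), LipschitzWith K H ∧ θ 0 = 0 ∧
      θ 1 = 2 * Real.pi ∧
      (∀ t : I, ‖Complex.equivRealProdCLM.symm (H (γ.toFun t)) -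
        Complex.exp (θ t * Complex.I)‖ ≤ 1 / 2) ∧
      ∀ z ∉ ball (γ.toFun t₀) ε, ‖Complex.equivRealProdCLM.symm (H z) - 1‖ ≤ 1 / 2 := by
  obtain ⟨δ, hδ, hδγ⟩ : ∃ δ > 0, ∀ t, |t - t₀| < δ → t ∈ Ioo (0 : ℝ) 1 ∧
      γ.toFun t ∈ ball (γ.toFun t₀) (ε / 2) := by
    have h1 : ∀ᶠ t in 𝓝 t₀, t ∈ Ioo (0 : ℝ) 1 := Ioo_mem_nhds ht₀.1 ht₀.2
    have h2 : ∀ᶠ t in 𝓝 t₀, γ.toFun t ∈ ball (γ.toFun t₀) (ε / 2) :=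
      (γ.contOn.continuousAt (Icc_mem_nhds ht₀.1 ht₀.2)) (ball_mem_nhds _ (by positivity))
    obtain ⟨δ, hδ, h⟩ := Metric.eventually_nhds_iff.mp (h1.and h2)
    exact ⟨δ, hδ, fun t ht => h (by rwa [Real.dist_eq])⟩
  let θ : C(I, ℝ) :=
    ⟨fun t => 2 * Real.pi * max 0 (min 1 (((t : ℝ) - t₀ + δ) / (2 * δ))), by fun_prop⟩
  have hθl : ∀ t : I, (t : ℝ) ≤ t₀ - δ → θ t = 0 := by
    intro t ht
    have : ((t : ℝ) - t₀ + δ) / (2 * δ) ≤ 0 := div_nonpos_of_nonpos_of_nonneg (by linarith)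
      (by positivity)
    change 2 * Real.pi * max 0 (min 1 _) = 0
    rw [max_eq_left ((min_le_right _ _).trans this), mul_zero]
  have hθr : ∀ t : I, t₀ + δ ≤ (t : ℝ) → θ t = 2 * Real.pi := by
    intro t ht
    have : 1 ≤ ((t : ℝ) - t₀ + δ) / (2 * δ) := by rw [le_div_iff₀ (by positivity)]; linarith
    change 2 * Real.pi * max 0 (min 1 _) = _
    rw [min_eq_left this, max_eq_right zero_le_one, mul_one]
  have hθ0 : θ 0 = 0 := hθl 0 <| by
    by_contra! h
    exact lt_irrefl _ (hδγ 0 (by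
      rw [zero_sub, abs_neg, abs_of_pos ht₀.1]
      simpa using h)).1.1
  have hθ1 : θ 1 = 2 * Real.pi := hθr 1 <| by
    by_contra! h
    refine lt_irrefl _ (hδγ 1 ?_).1.2
    rw [abs_of_pos (by linarith [ht₀.2])]
    change (1 : ℝ) < t₀ + δ at h
    linarith
  let E : C(I, ℂ) := ⟨fun t => Complex.exp (θ t * Complex.I) - 1, by fun_prop⟩
  have hE0 : ∀ t : I, γ.toFun t ∉ ball (γ.toFun t₀) (ε / 2) → E t = 0 := by
    intro t ht
    have h : δ ≤ |(t : ℝ) - t₀| := by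
      by_contra! h
      exact ht (hδγ t h).2
    rcases le_abs.mp h with h | h
    · simp [E, hθr t (by linarith)]
    · simp [E, hθl t (by linarith)]
  obtain ⟨f, hfc, hfγ, hf0⟩ := γ.exists_continuousOn_comp_eq E (by simp [E, hθ0])
    (by simp [E, hθ1])
  have hfball : ∀ z ∉ ball (γ.toFun t₀) (ε / 2), f z = 0 := by
    intro z hz
    by_cases hzγ : z ∈ γ.img
    · obtain ⟨t, ht, rfl⟩ := hzγ
      exact (hfγ ⟨t, ht⟩).trans (hE0 ⟨t, ht⟩ hz)
    · exact hf0 z hzγ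
  have hfb : ∀ z, ‖f z‖ ≤ 2 := by
    intro z
    by_cases hzγ : z ∈ γ.img
    · obtain ⟨t, ht, rfl⟩ := hzγ
      refine (congrArg norm (hfγ ⟨t, ht⟩)).trans_le ?_
      refine (norm_sub_le _ _).trans ?_
      rw [Complex.norm_exp_ofReal_mul_I, norm_one]
      norm_num
    · simp [hf0 z hzγ]
  have hfu : UniformContinuousOn f (γ.img ∪ (ball (γ.toFun t₀) ε)ᶜ) := by
    rw [Metric.uniformContinuousOn_iff]
    intro η hη
    obtain ⟨r, hr, h⟩ := Metric.uniformContinuousOn_iff.mp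
      (γ.isCompact_img.uniformContinuousOn_of_continuous hfc) η hη
    refine ⟨min r (ε / 2), by positivity, ?_⟩
    have hfar : ∀ y z, y ∉ ball (γ.toFun t₀) ε → dist y z < min r (ε / 2) →
        f y = 0 ∧ f z = 0 := by
      intro y z hy hyz
      rw [mem_ball, not_lt] at hy
      refine ⟨hfball y fun h => ?_, hfball z fun h => ?_⟩
      · linarith [mem_ball.mp h]
      · linarith [mem_ball.mp h, dist_triangle y z (γ.toFun t₀), min_le_right r (ε / 2)]
    rintro y (hy | hy) z (hz | hz) hyz
    · exact h y hy z hz (hyz.trans_le (min_le_left _ _))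
    · have := hfar z y hz (by rwa [dist_comm])
      simpa [this.1, this.2] using hη
    all_goals
      have := hfar y z hy hyz
      simpa [this.1, this.2] using hη
  obtain ⟨K₁, g₁, hg₁, h₁⟩ := exists_lipschitzWith_abs_sub_le (f := fun z => (f z).re) (M := 2)
    (fun z _ => (Complex.abs_re_le_norm _).trans (hfb z))
    (Complex.reCLM.uniformContinuous.comp_uniformContinuousOn hfu) (η := 1 / 4) (by norm_num)
  obtain ⟨K₂, g₂, hg₂, h₂⟩ := exists_lipschitzWith_abs_sub_le (f := fun z => (f z).im) (M := 2)
    (fun z _ => (Complex.abs_im_le_norm _).trans (hfb z))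
    (Complex.imCLM.uniformContinuous.comp_uniformContinuousOn hfu) (η := 1 / 4) (by norm_num)
  have hclose : ∀ z ∈ γ.img ∪ (ball (γ.toFun t₀) ε)ᶜ,
      ‖Complex.equivRealProdCLM.symm (1 + g₁ z, g₂ z) - (1 + f z)‖ ≤ 1 / 2 := by
    intro z hz
    refine (Complex.norm_le_abs_re_add_abs_im _).trans ?_
    have e1 : (Complex.equivRealProdCLM.symm (1 + g₁ z, g₂ z) - (1 + f z)).re =
      g₁ z - (f z).re := by simp
    have e2 : (Complex.equivRealProdCLM.symm (1 + g₁ z, g₂ z) - (1 + f z)).im =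
      g₂ z - (f z).im := by simp
    rw [e1, e2]
    linarith [h₁ z hz, h₂ z hz]
  refine ⟨_, fun z => (1 + g₁ z, g₂ z), θ, ((LipschitzWith.const (1 : ℝ)).add hg₁).prodMk hg₂,
    hθ0, hθ1, fun t => ?_, fun z hz => ?_⟩
  · have := hclose (γ.toFun t) (Or.inl (mem_image_of_mem _ t.2))
    rw [hfγ] at this
    simpa [E] using this
  · have := hclose z (Or.inr hz)
    rwa [hfball z fun h => hz (ball_subset_ball (by linarith) h), add_zero] at this

end Cat2Cx

end

section

open scoped unitInterval Topology

namespace Cat2Cx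

variable {X : Type*} [MetricSpace X]

/-- A closed path that is closer than `1` to a path winding once around the unit circle has no
closed logarithm. -/
lemma not_hasClosedLog_of_norm_sub_lt {p : I → ℂ} (hp : Continuous p) (hp01 : p 0 = p 1)
    {θ : C(I, ℝ)} (h0 : θ 0 = 0) (h1 : θ 1 = 2 * Real.pi)
    (h : ∀ t, ‖p t - Complex.exp (θ t * Complex.I)‖ < 1) : ¬ HasClosedLog p := by
  rintro ⟨ψ, hψ, hψ01⟩
  have hslit : ∀ t, p t / Complex.exp (θ t * Complex.I) ∈ Complex.slitPlane := fun t =>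
    div_mem_slitPlane (by rw [Complex.norm_exp_ofReal_mul_I]; exact h t)
  have hcont : Continuous fun t => p t / Complex.exp (θ t * Complex.I) :=
    hp.div (by fun_prop) fun t => Complex.exp_ne_zero _
  have hpne : ∀ t, p t ≠ 0 := fun t => by rw [← hψ]; exact Complex.exp_ne_zero _
  have key := eq_of_exp_comp_const
    (u := fun t => ψ t - Complex.log (p t / Complex.exp (θ t * Complex.I)) - θ t * Complex.I)
    ((ψ.continuous.sub (hcont.clog hslit)).sub (by fun_prop)) 1 (fun t => by
      have h1 := Complex.exp_ne_zero (θ t * Complex.I)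
      rw [Complex.exp_sub, Complex.exp_sub, hψ, Complex.exp_log (div_ne_zero (hpne t) h1)]
      field_simp [hpne t]) 0 1
  have he : Complex.exp (((2 * Real.pi : ℝ) : ℂ) * Complex.I) = 1 := by
    push_cast
    exact Complex.exp_two_pi_mul_I
  simp only [h0, h1, hψ01, hp01, he] at key
  simp at key
  exact Complex.two_pi_I_ne_zero (sub_eq_self.mp key.symm)

/-- The interior of a simple closed curve meets every ball around a point of the curve in a point
of a face. -/
lemma SCC.exists_mem_ball_interiorSet_inter_faces {κ : ℝ} (hκ : κ ≤ 0) (PC : PolyComplex2 κ X)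
    (hX : IsCATSpace κ X) (γ : SCC X) {t₀ : ℝ} (ht₀ : t₀ ∈ Ioo (0 : ℝ) 1) {ε : ℝ} (hε : 0 < ε) :
    ∃ d ∈ ball (γ.toFun t₀) ε, d ∈ γ.interiorSet ∩ ⋃₀ PC.faces := by
  wlog hfin : {c | (c ∈ PC.faces ∨ c ∈ PC.edges) ∧ (c ∩ ball (γ.toFun t₀) ε).Nonempty}.Finite ∧
      (PC.vertices ∩ ball (γ.toFun t₀) ε).Finite generalizing ε with key
  · obtain ⟨η, hη, h1, h2⟩ := PC.locally_finite (γ.toFun t₀)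
    have hsub : ball (γ.toFun t₀) (min ε η) ⊆ ball (γ.toFun t₀) η :=
      ball_subset_ball (min_le_right _ _)
    obtain ⟨d, hd, hd'⟩ := key (lt_min hε hη)
      ⟨h1.subset fun c hc => ⟨hc.1, hc.2.mono (inter_subset_inter_right _ hsub)⟩,
        h2.subset (inter_subset_inter_right _ hsub)⟩
    exact ⟨d, ball_subset_ball (min_le_left _ _) hd, hd'⟩
  by_contra! hno
  obtain ⟨K, H, θ, hH, hθ0, hθ1, hHγ, hHball⟩ := γ.exists_winding_lipschitzWith ht₀ hε
  obtain ⟨c, hc, hreg⟩ := PC.exists_regular_value hκ hH hfin.1 hfin.2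
    (show (0 : ℝ) < 1 / 4 by norm_num)
  have hc' : ‖Complex.equivRealProdCLM.symm c‖ < 1 / 2 := by
    have h1 := Complex.norm_le_abs_re_add_abs_im (Complex.equivRealProdCLM.symm c)
    have h2 : |c.1| ≤ ‖c‖ := norm_fst_le c
    have h3 : |c.2| ≤ ‖c‖ := norm_snd_le c
    change _ ≤ |c.1| + |c.2| at h1
    linarith
  let Hc : C(X, ℂ) := ⟨fun z => Complex.equivRealProdCLM.symm (H z - c),
    Complex.equivRealProdCLM.symm.continuous.comp (hH.continuous.sub continuous_const)⟩
  have hHc : ∀ z w, ‖Complex.equivRealProdCLM.symm (H z) - w‖ ≤ 1 / 2 → ‖Hc z - w‖ < 1 := by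
    intro z w h
    have : Hc z - w = (Complex.equivRealProdCLM.symm (H z) - w) -
        Complex.equivRealProdCLM.symm c := by
      change Complex.equivRealProdCLM.symm (H z - c) - w = _
      rw [map_sub]; ring
    rw [this]
    linarith [norm_sub_le (Complex.equivRealProdCLM.symm (H z) - w)
      (Complex.equivRealProdCLM.symm c)]
  have hclose : ∀ t : I, ‖Hc (γ.toFun t) - Complex.exp (θ t * Complex.I)‖ < 1 :=
    fun t => hHc _ _ (hHγ t)
  have hneγ : ∀ t : I, Hc (γ.toFun t) ≠ 0 := by
    intro t h
    have := hclose t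
    rw [h, zero_sub, norm_neg, Complex.norm_exp_ofReal_mul_I] at this
    exact lt_irrefl _ this
  obtain ⟨C, hC0, hC1, -⟩ := hX.exists_geodesic_contraction hκ (γ.toFun 0)
  have hγc : Continuous fun t : I => γ.toFun t :=
    γ.contOn.comp_continuous continuous_subtype_val fun t => t.2
  let Φ : C(I × I, X) := ⟨fun q => C (q.1, γ.toFun q.2),
    C.continuous.comp (continuous_fst.prodMk (hγc.comp continuous_snd))⟩
  have hΦ1 : (fun t : I => Φ (1, t)) = fun t : I => γ.toFun t := funext fun t => hC1 _
  have hlog : HasClosedLog fun t : I => Hc (Φ (1, t)) := by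
    refine hasClosedLog_of_removableZeros Φ (fun s => ?_) (fun t => ?_) Hc (fun t => ?_)
      fun d hd => ?_
    · change C (s, γ.toFun 0) = C (s, γ.toFun 1)
      rw [γ.loop]
    · exact (hC0 _).trans (hC0 _).symm
    · rw [show Φ (1, t) = γ.toFun t from hC1 _]
      exact hneγ t
    · rw [hΦ1]
      have hdball : d ∈ ball (γ.toFun t₀) ε := by
        by_contra h
        have := hHc d 1 (hHball d h)
        rw [hd, zero_sub, norm_neg, norm_one] at this
        exact lt_irrefl _ this
      have hdc : H d = c := by
        have : Complex.equivRealProdCLM.symm (H d - c) = 0 := hd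
        rwa [map_eq_zero_iff _ Complex.equivRealProdCLM.symm.injective, sub_eq_zero] at this
      obtain ⟨F, hF, hdF, f, G, hinj, hf, hG, hGd, hdet⟩ := hreg d hdball hdc
      refine γ.removableZero_of_notMem_interiorSet hκ hX (PC.faces_open F hF) hinj hf hdF ?_
        (fun h => hno d hdball ⟨h, F, hF, hdF⟩) Hc.continuous hd
        (G := fun u => G u - c) (fun z hz => ?_) (hGd.sub_const c) ?_
      · rintro ⟨t, ht, rfl⟩
        exact hneγ ⟨t, ht⟩ hd
      · rw [hG z hz]; rfl
      · rwa [fderiv_sub_const]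
  rw [show (fun t : I => Hc (Φ (1, t))) = fun t : I => Hc (γ.toFun t) from
    funext fun t => congrArg Hc (hC1 _)] at hlog
  exact not_hasClosedLog_of_norm_sub_lt (Hc.continuous.comp hγc)
    (congrArg Hc γ.loop) hθ0 hθ1 hclose hlog

/-- Every point of a simple closed curve is a limit of points with parameter in `(0, 1)`. -/
lemma SCC.exists_mem_Ioo_dist_lt (γ : SCC X) {x : X} (hx : x ∈ γ.img) {ε : ℝ} (hε : 0 < ε) :
    ∃ t ∈ Ioo (0 : ℝ) 1, dist (γ.toFun t) x < ε := by
  obtain ⟨t, ht, rfl⟩ := hx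
  have hcl : t ∈ closure (Ioo (0 : ℝ) 1) := by rwa [closure_Ioo zero_ne_one]
  have hnhds : ∀ᶠ s in 𝓝[Ioo (0 : ℝ) 1] t, dist (γ.toFun s) (γ.toFun t) < ε :=
    ((γ.contOn t ht).mono Ioo_subset_Icc_self) (ball_mem_nhds _ hε)
  have := mem_closure_iff_nhdsWithin_neBot.mp hcl
  obtain ⟨s, hs, hs'⟩ := (hnhds.and self_mem_nhdsWithin).exists
  exact ⟨s, hs', hs⟩

end Cat2Cx

end

open Cat2Cx in
/-- **Lemma (curve_theorem_1).**  Let `γ` be a simple closed curve in `X`.  Then `Int γ`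
accumulates on every point of `γ`; in fact the points of `Int γ` that lie on faces of `X`
so accumulate. -/
theorem interiorSet_accumulates_everywhere
    {κ : ℝ} (hκ : κ ≤ 0) {X : Type*} [MetricSpace X]
    (PC : PolyComplex2 κ X) (hX : IsCATSpace κ X)
    (γ : SCC X) (x : X) (hx : x ∈ γ.img) :
    AccPt x (Filter.principal γ.interiorSet) ∧
    AccPt x (Filter.principal (γ.interiorSet ∩ ⋃₀ PC.faces)) := by
  have h : AccPt x (Filter.principal (γ.interiorSet ∩ ⋃₀ PC.faces)) := by
    rw [accPt_iff_nhds]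
    intro U hU
    obtain ⟨ε, hε, hεU⟩ := Metric.mem_nhds_iff.mp hU
    obtain ⟨t, ht, hdist⟩ := γ.exists_mem_Ioo_dist_lt hx (half_pos hε)
    obtain ⟨d, hd, hd'⟩ := γ.exists_mem_ball_interiorSet_inter_faces hκ PC hX ht (half_pos hε)
    refine ⟨d, ⟨hεU ?_, hd'⟩, ?_⟩
    · rw [mem_ball] at hd ⊢
      linarith [dist_triangle d (γ.toFun t) x]
    · rintro rfl
      exact hd'.1.1 hx
  exact ⟨h.mono (Filter.principal_mono.mpr inter_subset_left), h⟩
end
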